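/- Let μ ∈ P be an integral weight, π ∈ B(μ) an LS path of shape μ, and i ∈ I. If m_i^π ≤ −1, then the root operator ẽ_i applied to π is again an LS path of shape μ (ẽ_iπ ∈ B(μ)); and if H_i^π(1) − m_i^π ≥ 1, then f̃_iπ is again an LS path of shape μ (f̃_iπ ∈ B(μ)). -/

import Mathlib

open scoped Classical
noncomputable section

namespace LSPaper

/-- The clamp of a real number to the interval `[0,1]`; paths `[0,1] → V` are
encoded as functions `ℝ → V` that factor through this clamp. -/
def clamp01 (t : ℝ) : ℝ := max 0 (min 1 t)

variable {V : Type*} [AddCommGroup V] [Module ℝ V]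

/-- The straight-line path `π_ν(t) = t ν` (clamped outside `[0,1]`). -/
def straight (ν : V) : ℝ → V := fun t => clamp01 t • ν

/-- The dilation `(mπ)(t) = m • π(t)`. -/
def dilate (m : ℕ) (f : ℝ → V) : ℝ → V := fun t => (m : ℝ) • f t

/-- The concatenation `π_1 * ⋯ * π_m` of a list of paths:
`(π_1 * ⋯ * π_m)(t) = Σ_{l<k} π_l(1) + π_k(mt - k + 1)` for
`(k-1)/m ≤ t ≤ k/m`. -/
def concatList (l : List (ℝ → V)) : ℝ → V := fun t =>
  let m := l.length
  let k : ℕ := max 1 (min m (⌈(m : ℝ) * t⌉.toNat))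
  (((l.take (k - 1)).map fun f => f 1).sum) +
    (l.getD (k - 1) 0) ((m : ℝ) * t - ((k : ℝ) - 1))

/-- Subdivision of a path into `m` pieces:
`π_k(t) = π(t/m + (k-1)/m) - π((k-1)/m)` (here `k` runs over `0, …, m-1`). -/
def subdiv (m : ℕ) (f : ℝ → V) : List (ℝ → V) :=
  List.ofFn fun k : Fin m => fun t : ℝ =>
    f ((clamp01 t + (k : ℝ)) / m) - f ((k : ℝ) / m)

/-- The map `Σ_m : B(μ) → B(μ)^{⊗m}` (tensor factors encoded as a list):
dilate by `m`, then subdivide into `m` pieces. -/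
def SigmaMap (m : ℕ) (f : ℝ → V) : List (ℝ → V) := subdiv m (dilate m f)

/-- The weight of a tensor product (encoded as a list of paths): the sum of
the weights of the factors. -/
def tensWt (l : List (ℝ → V)) : V := (l.map fun f => f 1).sum

/-- A symmetrizable generalized Cartan matrix together with a realization:
an integral weight lattice `P` inside a real vector space `V`, linearly
independent simple roots `α i ∈ P` and simple coroots (as linear functionals)
with `⟨α j, α i∨⟩ = a i j`, taking integer values on `P`. -/
structure KacMoodyData (I : Type*) (V : Type*) [Fintype I] [DecidableEq I]
    [AddCommGroup V] [Module ℝ V] where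
  a : I → I → ℤ
  d : I → ℤ
  P : AddSubgroup V
  α : I → V
  coroot : I → V →ₗ[ℝ] ℝ
  diag : ∀ i, a i i = 2
  offDiag : ∀ i j, i ≠ j → a i j ≤ 0
  zeroIff : ∀ i j, a i j = 0 ↔ a j i = 0
  dPos : ∀ i, 0 < d i
  symmetrizable : ∀ i j, d i * a i j = d j * a j i
  cartanPairing : ∀ i j, coroot i (α j) = (a i j : ℝ)
  rootsIndep : LinearIndependent ℝ α
  corootsIndep : LinearIndependent ℝ coroot
  rootMem : ∀ i, α i ∈ P
  pairingInt : ∀ i, ∀ v ∈ P, ∃ n : ℤ, coroot i v = (n : ℝ)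
  latticeFree : ∃ n : ℕ, Nonempty (P ≃+ (Fin n → ℤ))

namespace KacMoodyData

variable {I : Type*} [Fintype I] [DecidableEq I]
variable (K : KacMoodyData I V)

/-- The simple reflection `r_i(x) = x - ⟨x, α_i∨⟩ α_i` as a linear map. -/
def reflMap (i : I) : V →ₗ[ℝ] V := LinearMap.id - (K.coroot i).smulRight (K.α i)

lemma reflMap_invol (i : I) : Function.Involutive (K.reflMap i) := by
  intro x
  have h2 : K.coroot i (K.α i) = 2 := by
    have h := K.cartanPairing i i
    rw [K.diag i] at h
    simpa using h
  simp only [reflMap, LinearMap.sub_apply, LinearMap.id_apply, LinearMap.smulRight_apply,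
    map_sub, map_smul, smul_eq_mul, h2]
  module

/-- The simple reflection `r_i` as a linear automorphism of `V`. -/
def refl (i : I) : V ≃ₗ[ℝ] V :=
  { K.reflMap i with
    invFun := K.reflMap i
    left_inv := K.reflMap_invol i
    right_inv := K.reflMap_invol i }

/-- The Weyl group `W`, generated by the simple reflections. -/
def weylGroup : Subgroup (V ≃ₗ[ℝ] V) := Subgroup.closure (Set.range K.refl)

/-- The Weyl group orbit `W μ` of an integral weight. -/
def orbit (μ : V) : Set V := {ν | ∃ w ∈ K.weylGroup, ν = w μ}

/-- `Q_+ = Σ_i ℤ_{≥0} α_i`. -/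
def Qplus : Set V := {v | ∃ c : I → ℕ, v = ∑ i, (c i : ℝ) • K.α i}

/-- One step of the order on a Weyl group orbit:  `ν' = r_β(ν)` for a positive
real root `β = w α_i ∈ Q_+` (with `β∨ = w α_i∨`, `r_β = w r_i w⁻¹`) such that
`⟨ν, β∨⟩ < 0`. -/
def StepDown (ν ν' : V) : Prop :=
  ∃ w ∈ K.weylGroup, ∃ i : I, w (K.α i) ∈ K.Qplus ∧
    K.coroot i (w.symm ν) < 0 ∧ ν' = w (K.refl i (w.symm ν))

/-- There is a chain `ν = ξ_0, ξ_1, …, ξ_p = ν'` of steps down. -/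
def chainLen (p : ℕ) (ν ν' : V) : Prop :=
  ∃ ξ : ℕ → V, ξ 0 = ν ∧ ξ p = ν' ∧ ∀ q < p, K.StepDown (ξ q) (ξ (q + 1))

/-- `dist(ν, ν')`: the maximal length of a chain from `ν` down to `ν'`. -/
def dist (ν ν' : V) : ℕ := sSup {p | K.chainLen p ν ν'}

/-- A `σ`-chain for `(ν, ν')`: a sequence `ν = ξ_0 > ξ_1 > ⋯ > ξ_p = ν'` with
`dist(ξ_{q-1}, ξ_q) = 1` and `σ ⟨ξ_{q-1}, β_q∨⟩ ∈ ℤ_{<0}`, where `β_q` is the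
positive real root with `ξ_q = r_{β_q} ξ_{q-1}`. -/
def SigmaChain (σ : ℚ) (ν ν' : V) : Prop :=
  ∃ p : ℕ, 0 < p ∧ ∃ ξ : ℕ → V, ξ 0 = ν ∧ ξ p = ν' ∧
    ∀ q < p, K.dist (ξ q) (ξ (q + 1)) = 1 ∧
      ∃ w ∈ K.weylGroup, ∃ i : I, w (K.α i) ∈ K.Qplus ∧
        ξ (q + 1) = w (K.refl i (w.symm (ξ q))) ∧
        ∃ n : ℤ, n < 0 ∧ (σ : ℝ) * K.coroot i (w.symm (ξ q)) = (n : ℝ)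

/-- The combinatorial datum of a Lakshmibai–Seshadri path of shape `μ`:
a strictly decreasing sequence `ν_1 > ν_2 > ⋯ > ν_s` in `W μ` together with
rationals `0 = σ_0 < σ_1 < ⋯ < σ_s = 1` admitting `σ_u`-chains (the `ν`'s are
indexed here by `Fin s`, i.e. `0, …, s-1`). -/
structure LSData (K : KacMoodyData I V) (μ : V) where
  s : ℕ
  spos : 0 < s
  ν : Fin s → V
  τ : Fin (s + 1) → ℚ
  mem : ∀ u, ν u ∈ K.orbit μ
  strictDec : ∀ (u : ℕ) (h : u + 1 < s),
    Relation.TransGen K.StepDown (ν ⟨u, Nat.lt_of_succ_lt h⟩) (ν ⟨u + 1, h⟩)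
  τ_zero : τ 0 = 0
  τ_last : τ (Fin.last s) = 1
  τ_mono : StrictMono τ
  chainCond : ∀ (u : ℕ) (h : u + 1 < s),
    K.SigmaChain (τ ⟨u + 1, Nat.lt_succ_of_lt h⟩) (ν ⟨u, Nat.lt_of_succ_lt h⟩) (ν ⟨u + 1, h⟩)

/-- The piecewise-linear path `[0,1] → ℝ ⊗ P` associated with an LS datum:
`π(t) = Σ_{k<u} (σ_k - σ_{k-1}) ν_k + (t - σ_{u-1}) ν_u` for `σ_{u-1} ≤ t ≤ σ_u`,
encoded as the function `ℝ → V`, `t ↦ Σ_k (min t σ_{k+1} - min t σ_k) • ν_k`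
(which is constant for `t ≤ 0` and `t ≥ 1`). -/
def LSData.path {K : KacMoodyData I V} {μ : V} (π : K.LSData μ) : ℝ → V := fun t =>
  ∑ k : Fin π.s,
    ((min t ((π.τ k.succ : ℚ) : ℝ)) - (min t ((π.τ k.castSucc : ℚ) : ℝ))) • π.ν k

/-- `B(μ)`: the set of Lakshmibai–Seshadri paths of shape `μ`. -/
def B (μ : V) : Set (ℝ → V) := {f | ∃ π : K.LSData μ, f = π.path}

/-- `H_i^π(t) = ⟨π(t), α_i∨⟩`. -/
def H (i : I) (f : ℝ → V) : ℝ → ℝ := fun t => K.coroot i (f t)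

/-- `m_i^π = min {H_i^π(t) : t ∈ [0,1]}`. -/
def mval (i : I) (f : ℝ → V) : ℝ := sInf (K.H i f '' Set.Icc 0 1)

/-- The raising root operator `ẽ_i` (the underlying path, before testing
whether it is defined): with `t_1 = min {t : H_i^π(t) = m_i^π}` and
`t_0 = max {t ≤ t_1 : H_i^π(t) = m_i^π + 1}`, the new path is `π(t)` for
`t ≤ t_0`, `r_i(π(t) - π(t_0)) + π(t_0)` for `t_0 ≤ t ≤ t_1` and `π(t) + α_i`
for `t ≥ t_1`. -/
def eraw (i : I) (f : ℝ → V) : ℝ → V := fun t =>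
  let m := K.mval i f
  let t1 := sInf {t | t ∈ Set.Icc (0 : ℝ) 1 ∧ K.H i f t = m}
  let t0 := sSup {t | t ∈ Set.Icc (0 : ℝ) t1 ∧ K.H i f t = m + 1}
  if t ≤ t0 then f t
  else if t ≤ t1 then K.refl i (f t - f t0) + f t0
  else f t + K.α i

/-- The lowering root operator `f̃_i` (the underlying path): with
`t_0 = max {t : H_i^π(t) = m_i^π}` and `t_1 = min {t ≥ t_0 : H_i^π(t) = m_i^π + 1}`,
the new path is `π(t)` for `t ≤ t_0`, `r_i(π(t) - π(t_0)) + π(t_0)` for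
`t_0 ≤ t ≤ t_1` and `π(t) - α_i` for `t ≥ t_1`. -/
def fraw (i : I) (f : ℝ → V) : ℝ → V := fun t =>
  let m := K.mval i f
  let t0 := sSup {t | t ∈ Set.Icc (0 : ℝ) 1 ∧ K.H i f t = m}
  let t1 := sInf {t | t ∈ Set.Icc t0 1 ∧ K.H i f t = m + 1}
  if t ≤ t0 then f t
  else if t ≤ t1 then K.refl i (f t - f t0) + f t0
  else f t - K.α i

/-- The root operator `ẽ_i`, with value `none` (the formal element `0`) when
`m_i^π = 0`. -/
def eop (i : I) (f : ℝ → V) : Option (ℝ → V) :=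
  if K.mval i f = 0 then none else some (K.eraw i f)

/-- The root operator `f̃_i`, with value `none` (the formal element `0`) when
`H_i^π(1) - m_i^π = 0`. -/
def fop (i : I) (f : ℝ → V) : Option (ℝ → V) :=
  if K.H i f 1 - K.mval i f = 0 then none else some (K.fraw i f)

/-- `ẽ_i^n π` (with `ẽ_i 0 = 0`). -/
def eIter (i : I) (n : ℕ) (f : ℝ → V) : Option (ℝ → V) :=
  (fun o => o.bind (K.eop i))^[n] (some f)

/-- `f̃_i^n π` (with `f̃_i 0 = 0`). -/
def fIter (i : I) (n : ℕ) (f : ℝ → V) : Option (ℝ → V) :=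
  (fun o => o.bind (K.fop i))^[n] (some f)

/-- `ε_i(π) = max {n ≥ 0 : ẽ_i^n π ≠ 0}`. -/
def epsilon (i : I) (f : ℝ → V) : ℕ := sSup {n | K.eIter i n f ≠ none}

/-- `φ_i(π) = max {n ≥ 0 : f̃_i^n π ≠ 0}`. -/
def phi (i : I) (f : ℝ → V) : ℕ := sSup {n | K.fIter i n f ≠ none}

/-- The Weyl group action on a normal crystal:
`S_i b = f̃_i^{⟨wt b, α_i∨⟩} b` if `⟨wt b, α_i∨⟩ ≥ 0` and
`S_i b = ẽ_i^{-⟨wt b, α_i∨⟩} b` if `⟨wt b, α_i∨⟩ ≤ 0`. -/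
def Sop (i : I) (f : ℝ → V) : Option (ℝ → V) :=
  if 0 ≤ K.coroot i (f 1) then K.fIter i (⌊K.coroot i (f 1)⌋.toNat) f
  else K.eIter i ((-⌊K.coroot i (f 1)⌋).toNat) f

/-- `SWord K [i₁, …, i_k] b = S_{i₁} S_{i₂} ⋯ S_{i_k} b`. -/
def SWord (K : KacMoodyData I V) : List I → Option (ℝ → V) → Option (ℝ → V)
  | [], o => o
  | i :: rest, o => (SWord K rest o).bind (K.Sop i)

/-- `b` is extremal: for each `w ∈ W` (as a word in simple reflections) and
`i ∈ I`, `ẽ_i (S_w b) = 0` if `⟨wt (S_w b), α_i∨⟩ ≥ 0` and `f̃_i (S_w b) = 0`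
if `⟨wt (S_w b), α_i∨⟩ ≤ 0`. -/
def Extremal (f : ℝ → V) : Prop :=
  ∀ (l : List I) (g : ℝ → V), K.SWord l (some f) = some g →
    ∀ i : I, (0 ≤ K.coroot i (g 1) → K.eop i g = none) ∧
      (K.coroot i (g 1) ≤ 0 → K.fop i g = none)

/-- Application of a word in the Kashiwara operators (`true` stands for `ẽ`,
`false` for `f̃`), leftmost entry applied first. -/
def applyWord (K : KacMoodyData I V) :
    List (I × Bool) → Option (ℝ → V) → Option (ℝ → V)
  | [], o => o
  | p :: rest, o =>
      applyWord K rest (o.bind fun f => if p.2 then K.eop p.1 f else K.fop p.1 f)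

/-- `B(μ)^{*m}`: the set of `m`-fold concatenations of LS paths of shape `μ`. -/
def ConcatSet (μ : V) (m : ℕ) : Set (ℝ → V) :=
  {g | ∃ l : List (ℝ → V), l.length = m ∧ (∀ f ∈ l, f ∈ K.B μ) ∧ g = concatList l}

/-- `ε_i` of a tensor product (encoded as a list of paths, Kashiwara's rule):
`ε_i(b₁ ⊗ b₂) = max (ε_i b₁) (ε_i b₂ - ⟨wt b₁, α_i∨⟩)`. -/
def tensEps (K : KacMoodyData I V) (i : I) : List (ℝ → V) → ℤ
  | [] => 0
  | [b] => (K.epsilon i b : ℤ)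
  | b :: c :: rest =>
      max ((K.epsilon i b : ℤ)) (tensEps K i (c :: rest) - ⌊K.coroot i (b 1)⌋)

/-- `φ_i` of a tensor product (Kashiwara's rule):
`φ_i(b₁ ⊗ b₂) = max (φ_i b₂) (φ_i b₁ + ⟨wt b₂, α_i∨⟩)`. -/
def tensPhi (K : KacMoodyData I V) (i : I) : List (ℝ → V) → ℤ
  | [] => 0
  | [b] => (K.phi i b : ℤ)
  | b :: c :: rest =>
      max (tensPhi K i (c :: rest)) ((K.phi i b : ℤ) + ⌊K.coroot i (tensWt (c :: rest))⌋)

/-- `ẽ_i` on a tensor product (Kashiwara's rule):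
`ẽ_i(b₁ ⊗ b₂) = (ẽ_i b₁) ⊗ b₂` if `φ_i(b₁) ≥ ε_i(b₂)`, else `b₁ ⊗ (ẽ_i b₂)`. -/
def tensE (K : KacMoodyData I V) (i : I) : List (ℝ → V) → Option (List (ℝ → V))
  | [] => none
  | [b] => (K.eop i b).map fun b' => [b']
  | b :: c :: rest =>
      if K.tensEps i (c :: rest) ≤ (K.phi i b : ℤ) then
        (K.eop i b).map fun b' => b' :: c :: rest
      else (tensE K i (c :: rest)).map fun r' => b :: r'

/-- `f̃_i` on a tensor product (Kashiwara's rule):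
`f̃_i(b₁ ⊗ b₂) = (f̃_i b₁) ⊗ b₂` if `φ_i(b₁) > ε_i(b₂)`, else `b₁ ⊗ (f̃_i b₂)`. -/
def tensF (K : KacMoodyData I V) (i : I) : List (ℝ → V) → Option (List (ℝ → V))
  | [] => none
  | [b] => (K.fop i b).map fun b' => [b']
  | b :: c :: rest =>
      if K.tensEps i (c :: rest) < (K.phi i b : ℤ) then
        (K.fop i b).map fun b' => b' :: c :: rest
      else (tensF K i (c :: rest)).map fun r' => b :: r'

/-- `ẽ_i^n` on tensor products. -/
def tensEIter (i : I) (n : ℕ) (l : List (ℝ → V)) : Option (List (ℝ → V)) :=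
  (fun o => o.bind (K.tensE i))^[n] (some l)

/-- `f̃_i^n` on tensor products. -/
def tensFIter (i : I) (n : ℕ) (l : List (ℝ → V)) : Option (List (ℝ → V)) :=
  (fun o => o.bind (K.tensF i))^[n] (some l)

end KacMoodyData

end LSPaper

namespace LSPaper

namespace KacMoodyData

variable {V : Type*} [AddCommGroup V] [Module ℝ V]
variable {I : Type*} [Fintype I] [DecidableEq I]
variable (K : KacMoodyData I V)

section Reflections

lemma refl_apply (i : I) (x : V) : K.refl i x = x - K.coroot i x • K.α i := rfl

@[simp]
lemma coroot_α_self (i : I) : K.coroot i (K.α i) = 2 := by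
  rw [K.cartanPairing, K.diag]; norm_num

lemma refl_refl (i : I) (x : V) : K.refl i (K.refl i x) = x := K.reflMap_invol i x

@[simp]
lemma refl_mul_self (i : I) : K.refl i * K.refl i = 1 := by
  ext x; exact K.refl_refl i x

lemma refl_inv (i : I) : (K.refl i)⁻¹ = K.refl i := inv_eq_of_mul_eq_one_left (K.refl_mul_self i)

lemma coroot_refl_self (i : I) (x : V) : K.coroot i (K.refl i x) = - K.coroot i x := by
  simp [refl_apply]; ring

lemma refl_α_self (i : I) : K.refl i (K.α i) = - K.α i := by
  simp [refl_apply]; module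

lemma refl_mem (i : I) : K.refl i ∈ K.weylGroup := Subgroup.subset_closure ⟨i, rfl⟩

end Reflections

section Words

/-- The product of simple reflections along a word. -/
def wordProd (l : List I) : V ≃ₗ[ℝ] V := (l.map K.refl).prod

@[simp] lemma wordProd_nil : K.wordProd [] = 1 := rfl

@[simp] lemma wordProd_cons (i : I) (l : List I) :
    K.wordProd (i :: l) = K.refl i * K.wordProd l := by simp [wordProd]

@[simp] lemma wordProd_append (l l' : List I) :
    K.wordProd (l ++ l') = K.wordProd l * K.wordProd l' := by simp [wordProd]

lemma exists_word {w : V ≃ₗ[ℝ] V} (hw : w ∈ K.weylGroup) : ∃ l, K.wordProd l = w := by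
  induction hw using Subgroup.closure_induction'' with
  | one => exact ⟨[], rfl⟩
  | mem x hx => obtain ⟨i, rfl⟩ := hx; exact ⟨[i], by simp⟩
  | inv_mem x hx => obtain ⟨i, rfl⟩ := hx; exact ⟨[i], by simp [refl_inv]⟩
  | mul x y _ _ hx hy =>
    obtain ⟨l, rfl⟩ := hx
    obtain ⟨l', rfl⟩ := hy
    exact ⟨l ++ l', by simp⟩

/-- A word is reduced when no shorter word has the same product. -/
def Reduced (l : List I) : Prop :=
  ∀ l', K.wordProd l' = K.wordProd l → l.length ≤ l'.length

/-- Right multiplication by `r_i` does not shorten the (product of the) word. -/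
def NotShortenedBy (l : List I) (i : I) : Prop :=
  ∀ l', K.wordProd l' = K.wordProd l * K.refl i → l.length ≤ l'.length

variable {K}

lemma Reduced.suffix {l l' : List I} (h : K.Reduced (l ++ l')) : K.Reduced l' := by
  intro m hm
  have := h (l ++ m) (by simp [hm])
  simp at this; omega

lemma NotShortenedBy.suffix {l l' : List I} {i : I} (h : K.NotShortenedBy (l ++ l') i) :
    K.NotShortenedBy l' i := by
  intro m hm
  have := h (l ++ m) (by simp [hm, mul_assoc])
  simp at this; omega

variable (K)

lemma exists_reduced {w : V ≃ₗ[ℝ] V} (hw : w ∈ K.weylGroup) :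
    ∃ l, K.wordProd l = w ∧ K.Reduced l := by
  obtain ⟨l₀, h₀⟩ := K.exists_word hw
  have hex : ∃ n, ∃ l, l.length = n ∧ K.wordProd l = w := ⟨_, l₀, rfl, h₀⟩
  obtain ⟨l, hl, hlw⟩ := Nat.find_spec hex
  refine ⟨l, hlw, fun l' h' => ?_⟩
  rw [hl]
  exact Nat.find_min' hex ⟨l', rfl, h'.trans hlw⟩

end Words

section RankTwo

variable {i j : I}

/-- The `n`-th letter from the right in the alternating word ending in `j`. -/
def altLetter (i j : I) (n : ℕ) : I := if Even n then j else i

/-- The alternating word of length `n` in `i`, `j` ending in `j`. -/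
def altWord (i j : I) : ℕ → List I
  | 0 => []
  | n + 1 => altLetter i j n :: altWord i j n

@[simp] lemma length_altWord {J : Type*} (i j : J) (n : ℕ) : (altWord i j n).length = n := by
  induction n with
  | zero => rfl
  | succ n ih => simp [altWord, ih]

lemma altWord_suffix {J : Type*} {i j : J} (n k : ℕ) : ∃ l, altWord i j (n + k) = l ++ altWord i j n := by
  induction k with
  | zero => exact ⟨[], rfl⟩
  | succ k ih =>
    obtain ⟨l, hl⟩ := ih
    exact ⟨altLetter i j (n + k) :: l, by simp [altWord, hl]⟩

lemma eq_altWord {u : List I} (hu : ∀ k ∈ u, k = i ∨ k = j) (hr : K.Reduced u)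
    (hs : K.NotShortenedBy u i) : u = altWord i j u.length := by
  induction u with
  | nil => rfl
  | cons k u ih =>
    have ih' := ih (fun k hk => hu k (List.mem_cons_of_mem _ hk))
      (Reduced.suffix (l := [k]) hr) (NotShortenedBy.suffix (l := [k]) hs)
    have hk := hu k List.mem_cons_self
    rw [List.length_cons, altWord, ← ih']
    congr 1
    by_contra hne
    cases hn : u.length with
    | zero =>
      have hu0 : u = [] := List.length_eq_zero_iff.mp hn
      subst hu0
      have hki : k = i := by
        rcases hk with h | h
        · exact h
        · exact absurd (by simp [altLetter, h]) hne
      subst hki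
      have := hs [] (by simp)
      simp at this
    | succ n =>
      have hk' : k = altLetter i j n := by
        rw [hn] at hne
        unfold altLetter at hne ⊢
        by_cases he : Even n <;> simp [he, Nat.even_add_one] at hne ⊢ <;> tauto
      rw [hn, altWord, ← hk'] at ih'
      have := hr (altWord i j n) (by
        rw [ih']; simp [← mul_assoc])
      rw [ih'] at this
      simp at this

/-- Coordinates on `α_i`, `α_j` of the alternating word of length `n` applied to `α_i`. -/
def altCoeff (p q : ℤ) : ℕ → ℤ × ℤ
  | 0 => (1, 0)
  | n + 1 =>
    if Even n then ((altCoeff p q n).1, p * (altCoeff p q n).1 - (altCoeff p q n).2)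
    else (q * (altCoeff p q n).2 - (altCoeff p q n).1, (altCoeff p q n).2)

lemma wordProd_altWord (n : ℕ) :
    K.wordProd (altWord i j n) (K.α i) =
      ((altCoeff (-K.a j i) (-K.a i j) n).1 : ℝ) • K.α i
        + ((altCoeff (-K.a j i) (-K.a i j) n).2 : ℝ) • K.α j := by
  induction n with
  | zero => simp [altWord, altCoeff]
  | succ n ih =>
    rw [altWord, wordProd_cons, LinearEquiv.mul_apply, ih]
    unfold altLetter
    by_cases h : Even n
    · simp [altCoeff, h, refl_apply, K.cartanPairing, K.diag]
      module
    · simp [altCoeff, h, refl_apply, K.cartanPairing, K.diag]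
      module

lemma altCoeff_nonneg_of_four_le {p q : ℤ} (hp : 0 ≤ p) (hq : 0 ≤ q) (h : 4 ≤ p * q) (n : ℕ) :
    0 ≤ (altCoeff p q n).1 ∧ 0 ≤ (altCoeff p q n).2 ∧
      if Even n then q * (altCoeff p q n).2 ≤ 2 * (altCoeff p q n).1
      else p * (altCoeff p q n).1 ≤ 2 * (altCoeff p q n).2 := by
  induction n with
  | zero => simp [altCoeff]
  | succ n ih =>
    obtain ⟨h1, h2, h3⟩ := ih
    by_cases he : Even n
    · simp only [he, if_true, altCoeff, Nat.even_add_one, not_true, if_false] at h3 ⊢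
      generalize altCoeff p q n = c at *
      have h4 := mul_le_mul_of_nonneg_left h3 hp
      have h5 := mul_le_mul_of_nonneg_right h h2
      refine ⟨h1, ?_, ?_⟩ <;> nlinarith
    · simp only [he, if_false, altCoeff, Nat.even_add_one, not_false_eq_true, if_true] at h3 ⊢
      generalize altCoeff p q n = c at *
      have h4 := mul_le_mul_of_nonneg_left h3 hq
      have h5 := mul_le_mul_of_nonneg_right h h1
      refine ⟨?_, h2, ?_⟩ <;> nlinarith

lemma refl_lincomb_left (x : V) (A B : ℝ) :
    K.refl i (x - A • K.α i - B • K.α j) =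
      x - (K.coroot i x - A - K.a i j * B) • K.α i - B • K.α j := by
  simp [refl_apply, K.cartanPairing, K.diag]
  module

lemma refl_lincomb_right (x : V) (A B : ℝ) :
    K.refl j (x - A • K.α i - B • K.α j) =
      x - A • K.α i - (K.coroot j x - B - K.a j i * A) • K.α j := by
  simp [refl_apply, K.cartanPairing, K.diag]
  module

lemma length_lt_of_braid {u : List I} {n : ℕ} (hs : K.NotShortenedBy u i)
    (hu : u = altWord i j u.length) (l : List I) (hl : l.length < n)
    (h : ∀ x, K.wordProd (altWord i j n) (K.refl i x) = K.wordProd l x) : u.length < n := by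
  by_contra! hn
  obtain ⟨k, hk⟩ := Nat.exists_eq_add_of_le hn
  obtain ⟨v, hv⟩ := altWord_suffix (i := i) (j := j) n k
  rw [← hk, ← hu] at hv
  rw [hv] at hs
  have := hs.suffix l (by ext x; simp [h])
  simp at this
  omega

lemma altCoeff_nonneg {u : List I} (hij : i ≠ j) (hs : K.NotShortenedBy u i)
    (hu : u = altWord i j u.length) :
    0 ≤ (altCoeff (-K.a j i) (-K.a i j) u.length).1 ∧
      0 ≤ (altCoeff (-K.a j i) (-K.a i j) u.length).2 := by
  have hp : 0 ≤ -K.a j i := by have := K.offDiag j i hij.symm; omega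
  have hq : 0 ≤ -K.a i j := by have := K.offDiag i j hij; omega
  by_cases h4' : 4 ≤ (-K.a j i) * (-K.a i j)
  · have := altCoeff_nonneg_of_four_le hp hq h4' u.length
    exact ⟨this.1, this.2.1⟩
  have hzero := K.zeroIff i j
  have hb := fun n l hl h => K.length_lt_of_braid (n := n) hs hu l hl h
  have key : ∀ x A B, K.refl i (x - A • K.α i - B • K.α j) =
      x - (K.coroot i x - A - K.a i j * B) • K.α i - B • K.α j :=
    fun x A B => K.refl_lincomb_left x A B
  have key' : ∀ x A B, K.refl j (x - A • K.α i - B • K.α j) =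
      x - A • K.α i - (K.coroot j x - B - K.a j i * A) • K.α j :=
    fun x A B => K.refl_lincomb_right x A B
  have start : ∀ x, K.refl i x = x - K.coroot i x • K.α i - (0 : ℝ) • K.α j := by
    intro x; simp [refl_apply]
  have start' : ∀ x, K.refl j x = x - (0 : ℝ) • K.α i - K.coroot j x • K.α j := by
    intro x; simp [refl_apply]
  generalize K.a i j = a at *
  generalize K.a j i = b at *
  have hcases : (a = 0 ∧ b = 0) ∨ (a = -1 ∧ b = -1) ∨ (a = -1 ∧ b = -2) ∨ (a = -2 ∧ b = -1) ∨
      (a = -1 ∧ b = -3) ∨ (a = -3 ∧ b = -1) := by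
    by_cases ha : a = 0
    · exact Or.inl ⟨ha, hzero.1 ha⟩
    have hb0 : b ≠ 0 := fun h => ha (hzero.2 h)
    have h1 : a ≤ -1 := by omega
    have h2 : b ≤ -1 := by omega
    have h3 : -3 ≤ a := by nlinarith
    have h4 : -3 ≤ b := by nlinarith
    clear * - h1 h2 h3 h4 h4'
    interval_cases a <;> interval_cases b <;> omega
  generalize hN : u.length = N at *
  have small : ∀ M, M ≤ 6 → N < M →
      (∀ k < M, 0 ≤ (altCoeff (-b) (-a) k).1 ∧ 0 ≤ (altCoeff (-b) (-a) k).2) →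
      0 ≤ (altCoeff (-b) (-a) N).1 ∧ 0 ≤ (altCoeff (-b) (-a) N).2 :=
    fun M _ hM h => h N hM
  rcases hcases with h | h | h | h | h | h <;> obtain ⟨rfl, rfl⟩ := h
  · refine small 2 (by norm_num) (hb 2 [j] (by simp) fun x => ?_) (by decide)
    simp [altWord, altLetter]
    rw [start x, key', key, start' x]
    module
  · refine small 3 (by norm_num) (hb 3 [i, j] (by simp) fun x => ?_) (by decide)
    simp [altWord, altLetter, Nat.even_add_one]
    rw [start x, key', key, key', start' x, key]
    push_cast
    module
  · refine small 4 (by norm_num) (hb 4 [j, i, j] (by simp) fun x => ?_) (by decide)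
    simp [altWord, altLetter, Nat.even_add_one]
    rw [start x, key', key, key', key, start' x, key, key']
    push_cast
    module
  · refine small 4 (by norm_num) (hb 4 [j, i, j] (by simp) fun x => ?_) (by decide)
    simp [altWord, altLetter, Nat.even_add_one]
    rw [start x, key', key, key', key, start' x, key, key']
    push_cast
    module
  · refine small 6 (by norm_num) (hb 6 [j, i, j, i, j] (by simp) fun x => ?_) (by decide)
    simp [altWord, altLetter, Nat.even_add_one]
    rw [start x, key', key, key', key, key', key, start' x, key, key', key, key']
    push_cast
    module
  · refine small 6 (by norm_num) (hb 6 [j, i, j, i, j] (by simp) fun x => ?_) (by decide)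
    simp [altWord, altLetter, Nat.even_add_one]
    rw [start x, key', key, key', key, key', key, start' x, key, key', key, key']
    push_cast
    module

end RankTwo

section Positivity

lemma α_mem_Qplus (i : I) : K.α i ∈ K.Qplus :=
  ⟨fun k => if k = i then 1 else 0, by simp⟩

variable {K} in
lemma Qplus_add {x y : V} (hx : x ∈ K.Qplus) (hy : y ∈ K.Qplus) : x + y ∈ K.Qplus := by
  obtain ⟨c, rfl⟩ := hx
  obtain ⟨d, rfl⟩ := hy
  exact ⟨c + d, by simp [add_smul, Finset.sum_add_distrib]⟩

variable {K} in
lemma Qplus_smul {x : V} (hx : x ∈ K.Qplus) (n : ℕ) : (n : ℝ) • x ∈ K.Qplus := by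
  obtain ⟨c, rfl⟩ := hx
  exact ⟨fun i => n * c i, by simp [Finset.smul_sum, mul_smul]⟩

/-- A reduced word that `r_i` does not shorten from the right maps `α_i` to a positive root. -/
lemma wordProd_α_mem_Qplus (l : List I) (i : I) (hr : K.Reduced l) (hs : K.NotShortenedBy l i) :
    K.wordProd l (K.α i) ∈ K.Qplus := by
  induction hn : l.length using Nat.strong_induction_on generalizing l i with
  | _ n ih =>
  subst hn
  rcases List.eq_nil_or_concat l with rfl | ⟨l₁, j, rfl⟩
  · simpa using K.α_mem_Qplus i
  rw [List.concat_eq_append] at *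
  have hij : i ≠ j := by
    rintro rfl
    have := hs l₁ (by simp [mul_assoc])
    simp at this
  let Split : ℕ → Prop := fun m => ∃ v u : List I, v.length = m ∧ (∀ k ∈ u, k = i ∨ k = j) ∧
    K.wordProd (v ++ u) = K.wordProd (l₁ ++ [j]) ∧ (v ++ u).length = (l₁ ++ [j]).length
  have hex : ∃ m, Split m := ⟨_, l₁, [j], rfl, by simp, rfl, rfl⟩
  obtain ⟨v, u, hvm, hu, hprod, hlen⟩ := Nat.find_spec hex
  have hmin : ∀ v' u' : List I, (∀ k ∈ u', k = i ∨ k = j) →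
      K.wordProd (v' ++ u') = K.wordProd (l₁ ++ [j]) →
      (v' ++ u').length = (l₁ ++ [j]).length → v.length ≤ v'.length := fun v' u' h1 h2 h3 => by
    rw [hvm]; exact Nat.find_min' hex ⟨v', u', rfl, h1, h2, h3⟩
  have hr' : K.Reduced (v ++ u) := fun l' h => by
    rw [hlen]; exact hr l' (h.trans hprod)
  have hs' : K.NotShortenedBy (v ++ u) i := fun l' h => by
    rw [hlen]; exact hs l' (by rw [h, hprod])
  have hvlt : v.length < (l₁ ++ [j]).length := by
    have := hmin l₁ [j] (by simp) rfl rfl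
    simp; omega
  have hvr : K.Reduced v := fun l' h => by
    have := hr' (l' ++ u) (by simp [h])
    simp at this; exact this
  have hvs : ∀ k, k = i ∨ k = j → K.NotShortenedBy v k := by
    intro k hk l' h
    by_contra! hlt
    have e : K.wordProd (l' ++ k :: u) = K.wordProd (v ++ u) := by
      simp only [wordProd_append, wordProd_cons, h, mul_assoc]
      simp [← mul_assoc (K.refl k)]
    have h1 := hr' (l' ++ k :: u) e
    have h2 := hmin l' (k :: u) (by simpa using ⟨hk, hu⟩) (e.trans hprod)
      (by rw [← hlen]; simp at h1 ⊢; omega)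
    omega
  have hvi := ih _ hvlt v i hvr (hvs i (Or.inl rfl)) rfl
  have hvj := ih _ hvlt v j hvr (hvs j (Or.inr rfl)) rfl
  have hus := hs'.suffix
  have hualt := K.eq_altWord hu hr'.suffix hus
  obtain ⟨h1, h2⟩ := K.altCoeff_nonneg hij hus hualt
  have hα := K.wordProd_altWord (i := i) (j := j) u.length
  rw [← hualt] at hα
  rw [← hprod, wordProd_append, LinearEquiv.mul_apply, hα]
  obtain ⟨x, hx⟩ := Int.eq_ofNat_of_zero_le h1
  obtain ⟨y, hy⟩ := Int.eq_ofNat_of_zero_le h2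
  rw [hx, hy, map_add, map_smul, map_smul]
  exact_mod_cast Qplus_add (Qplus_smul hvi x) (Qplus_smul hvj y)

/-- Every real root is positive or negative. -/
theorem root_pos_or_neg {w : V ≃ₗ[ℝ] V} (hw : w ∈ K.weylGroup) (i : I) :
    w (K.α i) ∈ K.Qplus ∨ -w (K.α i) ∈ K.Qplus := by
  obtain ⟨l, rfl, hr⟩ := K.exists_reduced hw
  by_cases hs : K.NotShortenedBy l i
  · exact Or.inl (K.wordProd_α_mem_Qplus l i hr hs)
  right
  obtain ⟨m, hm, hmr⟩ := K.exists_reduced (K.weylGroup.mul_mem hw (K.refl_mem i))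
  have hml : m.length < l.length := by
    unfold NotShortenedBy at hs
    push Not at hs
    obtain ⟨l', h1, h2⟩ := hs
    exact (hmr l' (h1.trans hm.symm)).trans_lt h2
  have hms : K.NotShortenedBy m i := fun l' h => by
    rw [hm, mul_assoc, refl_mul_self, mul_one] at h
    exact hml.le.trans (hr l' h)
  have := K.wordProd_α_mem_Qplus m i hmr hms
  rwa [hm, LinearEquiv.mul_apply, refl_α_self, map_neg] at this

end Positivity

section Roots

/-- `β` is a positive real root with dual root `φ`. -/
structure PosRoot (β : V) (φ : V →ₗ[ℝ] ℝ) : Prop where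
  exists_weyl : ∃ w ∈ K.weylGroup, ∃ i, β = w (K.α i) ∧ φ = K.coroot i ∘ₗ (w⁻¹).toLinearMap
  mem_Qplus : β ∈ K.Qplus

lemma posRoot_of_weyl {w : V ≃ₗ[ℝ] V} (hw : w ∈ K.weylGroup) (i : I)
    (h : w (K.α i) ∈ K.Qplus) :
    K.PosRoot (w (K.α i)) (K.coroot i ∘ₗ (w⁻¹).toLinearMap) :=
  ⟨⟨w, hw, i, rfl, rfl⟩, h⟩

lemma posRoot_simple (i : I) : K.PosRoot (K.α i) (K.coroot i) :=
  ⟨⟨1, K.weylGroup.one_mem, i, rfl, by ext; simp⟩, K.α_mem_Qplus i⟩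

variable {K}

lemma weyl_refl_apply (w : V ≃ₗ[ℝ] V) (i : I) (x : V) :
    w (K.refl i (w.symm x)) = x - K.coroot i (w.symm x) • w (K.α i) := by
  simp [refl_apply]

lemma PosRoot.apply_self {β : V} {φ : V →ₗ[ℝ] ℝ} (h : K.PosRoot β φ) : φ β = 2 := by
  obtain ⟨w, -, i, rfl, rfl⟩ := h.exists_weyl
  simp

lemma PosRoot.ne_zero {β : V} {φ : V →ₗ[ℝ] ℝ} (h : K.PosRoot β φ) : β ≠ 0 := by
  rintro rfl
  simpa using h.apply_self

variable (K) in
/-- The coordinates of a real root determine those of its dual root. -/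
lemma exists_coords {w : V ≃ₗ[ℝ] V} (hw : w ∈ K.weylGroup) (j : I) :
    ∃ c : I → ℝ, w (K.α j) = ∑ k, c k • K.α k ∧
      ∀ x, (K.d j : ℝ) * K.coroot j (w⁻¹ x) = ∑ k, c k * K.d k * K.coroot k x := by
  obtain ⟨l, rfl⟩ := K.exists_word hw
  clear hw
  induction l with
  | nil => exact ⟨fun k => if k = j then 1 else 0, by simp, by simp⟩
  | cons i l ih =>
    obtain ⟨c, h1, h2⟩ := ih
    set β := K.wordProd l (K.α j) with hβ
    refine ⟨fun k => c k - if k = i then K.coroot i β else 0, ?_, fun x => ?_⟩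
    · simp only [wordProd_cons, LinearEquiv.mul_apply, ← hβ, refl_apply, sub_smul,
        Finset.sum_sub_distrib, ite_smul, zero_smul, Finset.sum_ite_eq', Finset.mem_univ,
        if_true, ← h1]
    · have hsum : ∑ k, c k * K.d k * K.a k i = K.d i * K.coroot i β := by
        rw [h1, map_sum, Finset.mul_sum]
        refine Finset.sum_congr rfl fun k _ => ?_
        have := congrArg (Int.cast (R := ℝ)) (K.symmetrizable k i)
        push_cast at this
        rw [map_smul, K.cartanPairing, smul_eq_mul]
        linear_combination c k * this
      rw [wordProd_cons, mul_inv_rev, refl_inv, LinearEquiv.mul_apply, h2, refl_apply]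
      simp only [map_sub, map_smul, K.cartanPairing, smul_eq_mul, mul_sub, sub_mul, ite_mul,
        zero_mul, Finset.sum_sub_distrib, Finset.sum_ite_eq', Finset.mem_univ, if_true]
      congr 1
      calc _ = K.coroot i x * ∑ k, c k * K.d k * K.a k i := by
            rw [Finset.mul_sum]; exact Finset.sum_congr rfl fun k _ => by ring
        _ = _ := by rw [hsum]; ring

/-- A positive root proportional to `α_i` has the same reflection as `α_i`. -/
lemma PosRoot.eq_of_smul {β : V} {φ : V →ₗ[ℝ] ℝ} (h : K.PosRoot β φ) {i : I} {c : ℝ}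
    (hc : β = c • K.α i) (x : V) : φ x * c = K.coroot i x := by
  have h2 := h.apply_self
  obtain ⟨w, hw, j, hβ, hφ⟩ := h.exists_weyl
  obtain ⟨e, h3, h4⟩ := K.exists_coords hw j
  have he : ∀ k, k ≠ i → e k = 0 := by
    intro k hk
    have h5 : ∑ k, (e k - if k = i then c else 0) • K.α k = 0 := by
      simp [sub_smul, ← h3, ← hβ, hc]
    have := Fintype.linearIndependent_iff.mp K.rootsIndep _ h5 k
    simpa [hk] using this
  have h6 : ∀ x, (K.d j : ℝ) * φ x = e i * K.d i * K.coroot i x := by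
    intro x
    have := h4 x
    rw [Finset.sum_eq_single i (fun k _ hk => by simp [he k hk]) (by simp)] at this
    rw [← this, hφ]; rfl
  have hd : (K.d j : ℝ) ≠ 0 := by exact_mod_cast (K.dPos j).ne'
  have h7 := h6 (K.α i)
  rw [hc, map_smul, smul_eq_mul] at h2
  rw [coroot_α_self] at h7
  have h8 := h6 x
  apply mul_left_cancel₀ hd
  linear_combination c * h8 + K.coroot i x / 2 * (K.d j * h2 - c * h7)

/-- A positive root that is not proportional to `α_i` stays positive under `r_i`. -/
lemma PosRoot.refl {β : V} {φ : V →ₗ[ℝ] ℝ} (h : K.PosRoot β φ) {i : I}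
    (hne : ∀ c : ℕ, β ≠ (c : ℝ) • K.α i) :
    K.PosRoot (K.refl i β) (φ ∘ₗ (K.refl i).toLinearMap) := by
  obtain ⟨w, hw, j, hβ, hφ⟩ := h.exists_weyl
  have hw' := K.weylGroup.mul_mem (K.refl_mem i) hw
  refine ⟨⟨K.refl i * w, hw', j, by simp [hβ], ?_⟩, ?_⟩
  · ext x
    simp [hφ, refl_inv]
  rcases K.root_pos_or_neg hw' j with hp | hp
  · simpa [hβ] using hp
  exfalso
  obtain ⟨c, hc⟩ := h.mem_Qplus
  obtain ⟨e, he⟩ := hp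
  rw [LinearEquiv.mul_apply, ← hβ, refl_apply] at he
  have h5 : ∑ k, ((c k : ℝ) + e k - if k = i then K.coroot i β else 0) • K.α k = 0 := by
    simp only [sub_smul, add_smul, Finset.sum_sub_distrib, Finset.sum_add_distrib, ite_smul,
      zero_smul, Finset.sum_ite_eq', Finset.mem_univ, if_true, ← he, ← hc]
    abel
  have h6 := Fintype.linearIndependent_iff.mp K.rootsIndep _ h5
  apply hne (c i)
  rw [hc]
  refine Finset.sum_eq_single i (fun k _ hk => ?_) (by simp)
  have := h6 k
  simp only [hk, if_false, sub_zero] at this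
  have : c k = 0 := by
    have h : c k + e k = 0 := by exact_mod_cast this
    omega
  simp [this]

lemma coroot_Qplus {β : V} (h : β ∈ K.Qplus) (i : I) : ∃ n : ℤ, K.coroot i β = n := by
  obtain ⟨c, rfl⟩ := h
  refine ⟨∑ k, c k * K.a i k, ?_⟩
  simp [K.cartanPairing]

lemma orbit_subset_P {μ ν : V} (hμ : μ ∈ K.P) (hν : ν ∈ K.orbit μ) : ν ∈ K.P := by
  obtain ⟨w, hw, rfl⟩ := hν
  obtain ⟨l, rfl⟩ := K.exists_word hw
  clear hw
  induction l with
  | nil => simpa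
  | cons i l ih =>
    rw [wordProd_cons, LinearEquiv.mul_apply, refl_apply]
    obtain ⟨n, hn⟩ := K.pairingInt i _ ih
    rw [hn, Int.cast_smul_eq_zsmul]
    exact K.P.sub_mem ih (K.P.zsmul_mem (K.rootMem i) n)

lemma refl_mem_orbit {μ ν : V} (hν : ν ∈ K.orbit μ) (i : I) : K.refl i ν ∈ K.orbit μ := by
  obtain ⟨w, hw, rfl⟩ := hν
  exact ⟨K.refl i * w, K.weylGroup.mul_mem (K.refl_mem i) hw, rfl⟩

end Roots

section Steps

variable {K} {ν ν' κ ξ : V} {i : I}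

lemma stepDown_iff : K.StepDown ν ν' ↔
    ∃ β φ, K.PosRoot β φ ∧ φ ν < 0 ∧ ν' = ν - φ ν • β := by
  constructor
  · rintro ⟨w, hw, i, h1, h2, rfl⟩
    exact ⟨_, _, K.posRoot_of_weyl hw i h1, h2, weyl_refl_apply w i ν⟩
  · rintro ⟨β, φ, ⟨⟨w, hw, i, rfl, rfl⟩, h⟩, h1, rfl⟩
    exact ⟨w, hw, i, h, h1, (weyl_refl_apply w i ν).symm⟩

lemma stepDown_refl (h : K.coroot i ν < 0) : K.StepDown ν (K.refl i ν) :=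
  stepDown_iff.mpr ⟨_, _, K.posRoot_simple i, h, rfl⟩

lemma stepDown_refl_left (h : 0 < K.coroot i ν) : K.StepDown (K.refl i ν) ν := by
  have := stepDown_refl (K := K) (i := i) (ν := K.refl i ν) (by rw [coroot_refl_self]; linarith)
  rwa [refl_refl] at this

/-- The reflection of `ν` in a positive root `β` is either `r_i ν`, or `r_i` may be applied to
the whole configuration. -/
lemma PosRoot.dichotomy {β : V} {φ : V →ₗ[ℝ] ℝ} (h : K.PosRoot β φ) (i : I) (ν : V) :
    (∃ c : ℕ, β = (c : ℝ) • K.α i ∧ ν - φ ν • β = K.refl i ν ∧ φ ν * c = K.coroot i ν) ∨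
    (K.PosRoot (K.refl i β) (φ ∘ₗ (K.refl i).toLinearMap) ∧
      (φ ∘ₗ (K.refl i).toLinearMap) (K.refl i ν) = φ ν ∧
      K.refl i (ν - φ ν • β) = K.refl i ν - φ ν • K.refl i β) := by
  by_cases hc : ∃ c : ℕ, β = (c : ℝ) • K.α i
  · left
    obtain ⟨c, hc⟩ := hc
    have := h.eq_of_smul hc ν
    exact ⟨c, hc, by rw [refl_apply, ← this, hc, smul_smul], this⟩
  · push Not at hc
    right
    exact ⟨h.refl hc, by simp [refl_refl], by simp⟩

lemma StepDown.refl_or (h : K.StepDown ν ν') (i : I) :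
    (ν' = K.refl i ν ∧ K.coroot i ν < 0) ∨ K.StepDown (K.refl i ν) (K.refl i ν') := by
  obtain ⟨β, φ, hr, hlt, rfl⟩ := stepDown_iff.mp h
  rcases hr.dichotomy i ν with ⟨c, hc, h1, h2⟩ | ⟨h1, h2, h3⟩
  · refine Or.inl ⟨h1, ?_⟩
    have hc0 : (0 : ℝ) < c := by
      rcases Nat.eq_zero_or_pos c with rfl | h0
      · exact absurd (by simpa using hc) hr.ne_zero
      · exact_mod_cast h0
    rw [← h2]; exact mul_neg_of_neg_of_pos hlt hc0
  · right
    exact stepDown_iff.mpr ⟨_, _, h1, by rwa [h2], by rw [h2, h3]⟩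

@[simp] lemma chainLen_zero : K.chainLen 0 ν ν' ↔ ν = ν' := by
  constructor
  · rintro ⟨ξ, rfl, rfl, -⟩; rfl
  · rintro rfl; exact ⟨fun _ => ν, rfl, rfl, by simp⟩

lemma chainLen_succ {p : ℕ} :
    K.chainLen (p + 1) ν ν' ↔ ∃ ξ, K.StepDown ν ξ ∧ K.chainLen p ξ ν' := by
  constructor
  · rintro ⟨ξ, rfl, rfl, h⟩
    exact ⟨ξ 1, h 0 (by omega), fun q => ξ (q + 1), rfl, rfl, fun q hq => h (q + 1) (by omega)⟩
  · rintro ⟨_, h, ξ, rfl, rfl, hξ⟩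
    refine ⟨fun q => Nat.casesOn q ν ξ, rfl, rfl, fun q hq => ?_⟩
    cases q with
    | zero => exact h
    | succ q => exact hξ q (by omega)

lemma chainLen_succ' {p : ℕ} :
    K.chainLen (p + 1) ν ν' ↔ ∃ ξ, K.chainLen p ν ξ ∧ K.StepDown ξ ν' := by
  induction p generalizing ν with
  | zero => simp [chainLen_succ]
  | succ p ih =>
    rw [chainLen_succ]
    simp only [ih]
    constructor
    · rintro ⟨ξ, h, η, h1, h2⟩
      exact ⟨η, chainLen_succ.mpr ⟨ξ, h, h1⟩, h2⟩
    · rintro ⟨η, h1, h2⟩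
      obtain ⟨ξ, h, h3⟩ := chainLen_succ.mp h1
      exact ⟨ξ, h, η, h3, h2⟩

lemma chainLen_one : K.chainLen 1 ν ν' ↔ K.StepDown ν ν' := by simp [chainLen_succ]

lemma chainLen_exists_coords {p : ℕ} (h : K.chainLen p ν ν') :
    ∃ c : I → ℝ, (∀ k, 0 ≤ c k) ∧ ν' = ν + ∑ k, c k • K.α k ∧ (p ≠ 0 → c ≠ 0) := by
  induction p generalizing ν with
  | zero => exact ⟨0, by simp, by simpa [eq_comm] using h, by simp⟩
  | succ p ih =>
    obtain ⟨ξ, h1, h2⟩ := chainLen_succ.mp h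
    obtain ⟨c, hc, rfl, -⟩ := ih h2
    obtain ⟨β, φ, hr, hlt, rfl⟩ := stepDown_iff.mp h1
    obtain ⟨e, he⟩ := hr.mem_Qplus
    refine ⟨fun k => c k - φ ν * e k, fun k => ?_, ?_, fun _ h0 => hr.ne_zero ?_⟩
    · nlinarith [hc k, (Nat.cast_nonneg (e k) : (0 : ℝ) ≤ e k)]
    · simp only [sub_smul, Finset.sum_sub_distrib, mul_smul, ← Finset.smul_sum, ← he]
      abel
    · rw [he]
      refine Finset.sum_eq_zero fun k _ => ?_
      have h3 := congrFun h0 k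
      simp only [Pi.zero_apply] at h3
      have h4 : (e k : ℝ) = 0 := by
        nlinarith [hc k, (Nat.cast_nonneg (e k) : (0 : ℝ) ≤ e k)]
      simp [h4]

lemma chainLen_self {p : ℕ} (h : K.chainLen p ν ν) : p = 0 := by
  obtain ⟨c, -, h1, h2⟩ := chainLen_exists_coords h
  by_contra hp
  refine h2 hp (funext fun k => ?_)
  exact Fintype.linearIndependent_iff.mp K.rootsIndep c (by simpa using h1) k

lemma chainLen.refl_left {p : ℕ} (h : K.chainLen p ν κ) (hν : K.coroot i ν < 0)
    (hκ : 0 ≤ K.coroot i κ) : ∃ p', p ≤ p' + 1 ∧ K.chainLen p' (K.refl i ν) κ := by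
  induction p generalizing ν with
  | zero => rw [chainLen_zero] at h; subst h; linarith
  | succ p ih =>
    obtain ⟨ξ, h1, h2⟩ := chainLen_succ.mp h
    rcases h1.refl_or i with ⟨rfl, -⟩ | h3
    · exact ⟨p, le_rfl, h2⟩
    rcases lt_trichotomy (K.coroot i ξ) 0 with h4 | h4 | h4
    · obtain ⟨p', h5, h6⟩ := ih h2 h4
      exact ⟨p' + 1, by omega, chainLen_succ.mpr ⟨_, h3, h6⟩⟩
    · rw [refl_apply K i ξ, h4, zero_smul, sub_zero] at h3
      exact ⟨p + 1, by omega, chainLen_succ.mpr ⟨_, h3, h2⟩⟩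
    · exact ⟨p + 2, by omega, chainLen_succ.mpr ⟨_, h3, chainLen_succ.mpr
        ⟨_, stepDown_refl_left h4, h2⟩⟩⟩

lemma chainLen.refl_right {p : ℕ} (h : K.chainLen p ν κ) (hν : K.coroot i ν ≤ 0)
    (hκ : 0 < K.coroot i κ) : ∃ p', p ≤ p' + 1 ∧ K.chainLen p' ν (K.refl i κ) := by
  induction p generalizing κ with
  | zero => rw [chainLen_zero] at h; subst h; linarith
  | succ p ih =>
    obtain ⟨ξ, h2, h1⟩ := chainLen_succ'.mp h
    rcases h1.refl_or i with ⟨rfl, -⟩ | h3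
    · exact ⟨p, le_rfl, by rwa [refl_refl]⟩
    rcases lt_trichotomy (K.coroot i ξ) 0 with h4 | h4 | h4
    · exact ⟨p + 2, by omega, chainLen_succ'.mpr ⟨_, chainLen_succ'.mpr
        ⟨_, h2, stepDown_refl h4⟩, h3⟩⟩
    · rw [refl_apply K i ξ, h4, zero_smul, sub_zero] at h3
      exact ⟨p + 1, by omega, chainLen_succ'.mpr ⟨_, h2, h3⟩⟩
    · obtain ⟨p', h5, h6⟩ := ih h2 h4
      exact ⟨p' + 1, by omega, chainLen_succ'.mpr ⟨_, h6, h3⟩⟩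

lemma dist_eq_one_iff :
    K.dist ν ν' = 1 ↔ K.StepDown ν ν' ∧ ∀ p, K.chainLen p ν ν' → p ≤ 1 := by
  unfold dist
  constructor
  · intro h
    have hne : {p | K.chainLen p ν ν'}.Nonempty := by
      by_contra h0
      rw [Set.not_nonempty_iff_eq_empty] at h0
      simp [h0] at h
    have hb : BddAbove {p | K.chainLen p ν ν'} := by
      by_contra h0
      rw [Nat.sSup_of_not_bddAbove h0] at h
      omega
    refine ⟨chainLen_one.mp ?_, fun p hp => ?_⟩
    · have := Nat.sSup_mem hne hb
      rwa [h] at this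
    · rw [← h]; exact le_csSup hb hp
  · rintro ⟨h1, h2⟩
    exact IsGreatest.csSup_eq ⟨chainLen_one.mpr h1, h2⟩

lemma dist_refl_eq_one (h : K.coroot i ν < 0) : K.dist ν (K.refl i ν) = 1 := by
  refine dist_eq_one_iff.mpr ⟨stepDown_refl h, fun p hp => ?_⟩
  obtain ⟨p', h1, h2⟩ := hp.refl_left h (by rw [coroot_refl_self]; linarith)
  have := chainLen_self h2
  omega

lemma eq_refl_of_dist (h : K.dist ν ν' = 1) (hν : K.coroot i ν ≤ 0) (hν' : 0 ≤ K.coroot i ν')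
    (hlt : K.coroot i ν < K.coroot i ν') : ν' = K.refl i ν := by
  obtain ⟨h1, h2⟩ := dist_eq_one_iff.mp h
  rcases h1.refl_or i with h3 | h3
  · exact h3.1
  exfalso
  rcases hν.lt_or_eq with hν | hν
  · rcases hν'.lt_or_eq with hν' | hν'
    · have := h2 3 (chainLen_succ.mpr ⟨_, stepDown_refl hν, chainLen_succ.mpr ⟨_, h3,
        chainLen_one.mpr (stepDown_refl_left hν')⟩⟩)
      omega
    · rw [refl_apply K i ν', ← hν', zero_smul, sub_zero] at h3
      have := h2 2 (chainLen_succ.mpr ⟨_, stepDown_refl hν, chainLen_one.mpr h3⟩)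
      omega
  · rw [refl_apply K i ν, hν, zero_smul, sub_zero] at h3
    have := h2 2 (chainLen_succ.mpr ⟨_, h3, chainLen_one.mpr (stepDown_refl_left (hν ▸ hlt))⟩)
    omega

lemma dist_refl_refl (h : K.dist ν ν' = 1) (hs : 0 < K.coroot i ν * K.coroot i ν') :
    K.dist (K.refl i ν) (K.refl i ν') = 1 := by
  obtain ⟨h1, h2⟩ := dist_eq_one_iff.mp h
  refine dist_eq_one_iff.mpr ⟨?_, fun p hp => ?_⟩
  · rcases h1.refl_or i with ⟨rfl, -⟩ | h3
    · rw [coroot_refl_self] at hs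
      nlinarith [sq_nonneg (K.coroot i ν)]
    · exact h3
  · rcases pos_and_pos_or_neg_and_neg_of_mul_pos hs with ⟨ha, hb⟩ | ⟨ha, hb⟩
    · have h3 := chainLen_succ'.mpr ⟨_, hp, stepDown_refl_left hb⟩
      obtain ⟨p', h4, h5⟩ := h3.refl_left (i := i) (by rw [coroot_refl_self]; linarith) hb.le
      rw [refl_refl] at h5
      have := h2 _ h5
      omega
    · have h3 := chainLen_succ.mpr ⟨_, stepDown_refl ha, hp⟩
      obtain ⟨p', h4, h5⟩ := h3.refl_right (i := i) ha.le (by rw [coroot_refl_self]; linarith)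
      rw [refl_refl] at h5
      have := h2 _ h5
      omega

end Steps

section SigmaSteps

variable {K} {ν ν' κ ξ : V} {i : I} {σ : ℚ}

variable (K σ) in
/-- One step of a `σ`-chain. -/
def SigmaStep (ν ν' : V) : Prop :=
  K.dist ν ν' = 1 ∧ ∃ β φ, K.PosRoot β φ ∧ ν' = ν - φ ν • β ∧ ∃ n : ℤ, n < 0 ∧ σ * φ ν = n

lemma sigmaStep_iff : K.SigmaStep σ ν ν' ↔ K.dist ν ν' = 1 ∧
    ∃ w ∈ K.weylGroup, ∃ i : I, w (K.α i) ∈ K.Qplus ∧ ν' = w (K.refl i (w.symm ν)) ∧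
      ∃ n : ℤ, n < 0 ∧ (σ : ℝ) * K.coroot i (w.symm ν) = (n : ℝ) := by
  refine and_congr_right fun _ => ⟨?_, ?_⟩
  · rintro ⟨β, φ, ⟨⟨w, hw, i, rfl, rfl⟩, h⟩, h1, h2⟩
    exact ⟨w, hw, i, h, by rw [weyl_refl_apply]; exact h1, h2⟩
  · rintro ⟨w, hw, i, h1, h2, h3⟩
    exact ⟨_, _, K.posRoot_of_weyl hw i h1, by rw [h2, weyl_refl_apply]; rfl, h3⟩

lemma sigmaChain_iff : K.SigmaChain σ ν ν' ↔ Relation.TransGen (K.SigmaStep σ) ν ν' := by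
  constructor
  · rintro ⟨p, hp, ξ, rfl, rfl, h⟩
    have h' : ∀ q < p, K.SigmaStep σ (ξ q) (ξ (q + 1)) := fun q hq => sigmaStep_iff.mpr (h q hq)
    clear h
    obtain ⟨p, rfl⟩ := Nat.exists_eq_succ_of_ne_zero hp.ne'
    clear hp
    induction p with
    | zero => exact .single (h' 0 (by omega))
    | succ p ih => exact (ih fun q hq => h' q (by omega)).tail (h' (p + 1) (by omega))
  · intro h
    suffices ∃ p : ℕ, 0 < p ∧ ∃ ξ : ℕ → V, ξ 0 = ν ∧ ξ p = ν' ∧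
        ∀ q < p, K.SigmaStep σ (ξ q) (ξ (q + 1)) by
      obtain ⟨p, hp, ξ, h1, h2, h3⟩ := this
      exact ⟨p, hp, ξ, h1, h2, fun q hq => sigmaStep_iff.mp (h3 q hq)⟩
    induction h using Relation.TransGen.head_induction_on with
    | @single a h =>
      exact ⟨1, one_pos, fun q => Nat.casesOn q a fun _ => ν', rfl, rfl, by simpa using h⟩
    | @head a _ h _ ih =>
      obtain ⟨p, hp, ξ, rfl, rfl, h3⟩ := ih
      refine ⟨p + 1, by omega, fun q => Nat.casesOn q a ξ, rfl, rfl, fun q hq => ?_⟩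
      cases q with
      | zero => exact h
      | succ q => exact h3 q (by omega)

lemma SigmaStep.stepDown (h : K.SigmaStep σ ν ν') : K.StepDown ν ν' :=
  (dist_eq_one_iff.mp h.1).1

lemma SigmaStep.coroot_sub (h : K.SigmaStep σ ν ν') (i : I) :
    ∃ n : ℤ, σ * K.coroot i ν' = σ * K.coroot i ν + n := by
  obtain ⟨-, β, φ, hr, rfl, n, -, hn⟩ := h
  obtain ⟨m, hm⟩ := coroot_Qplus hr.mem_Qplus i
  refine ⟨-(n * m), ?_⟩
  simp only [map_sub, map_smul, smul_eq_mul, hm]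
  push_cast
  linear_combination -m * hn

/-- A step crossing the wall of `α_i` upwards is the reflection `r_i`. -/
lemma SigmaStep.crossing (h : K.SigmaStep σ ν ν') (hν : K.coroot i ν ≤ 0)
    (hν' : 0 ≤ K.coroot i ν') (hlt : K.coroot i ν < K.coroot i ν') :
    ν' = K.refl i ν ∧ ∃ n : ℤ, σ * K.coroot i ν = n := by
  have heq := eq_refl_of_dist h.1 hν hν' hlt
  refine ⟨heq, ?_⟩
  obtain ⟨-, β, φ, hr, h1, n, -, hn⟩ := h
  rcases hr.dichotomy i ν with ⟨c, -, -, h3⟩ | ⟨h2, h3, h4⟩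
  · exact ⟨n * c, by rw [← h3, ← mul_assoc, hn]; norm_cast⟩
  · exfalso
    have hν0 : K.coroot i ν ≠ 0 := by
      intro h0
      rw [heq, coroot_refl_self, h0] at hlt
      simp at hlt
    have e : φ ν • β = K.coroot i ν • K.α i := by
      have := h1.symm.trans heq
      rw [refl_apply] at this
      simpa using this
    have hφ : φ ν ≠ 0 := by
      intro h0
      rw [h0, zero_smul, eq_comm, smul_eq_zero] at e
      rcases e with e | e
      · exact hν0 e
      · exact K.rootsIndep.ne_zero i e
    obtain ⟨c, hc⟩ := hr.mem_Qplus
    obtain ⟨d, hd⟩ := h2.mem_Qplus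
    have hβ : β = (φ ν)⁻¹ • K.coroot i ν • K.α i := by
      rw [← e, smul_smul, inv_mul_cancel₀ hφ, one_smul]
    have hneg : K.refl i β = - β := by
      rw [hβ, map_smul, map_smul, refl_α_self]; module
    have hsum : ∑ k, ((c k : ℝ) + d k) • K.α k = 0 := by
      simp only [add_smul, Finset.sum_add_distrib, ← hc, ← hd, hneg]; abel
    apply hr.ne_zero
    rw [hc]
    refine Finset.sum_eq_zero fun k _ => ?_
    have h5 := Fintype.linearIndependent_iff.mp K.rootsIndep _ hsum k
    have : c k = 0 := by
      have h : c k + d k = 0 := by exact_mod_cast h5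
      omega
    simp [this]

lemma SigmaStep.refl (h : K.SigmaStep σ ν ν') (hs : 0 < K.coroot i ν * K.coroot i ν') :
    K.SigmaStep σ (K.refl i ν) (K.refl i ν') := by
  refine ⟨dist_refl_refl h.1 hs, ?_⟩
  obtain ⟨-, β, φ, hr, rfl, hn⟩ := h
  rcases hr.dichotomy i ν with ⟨c, -, h2, -⟩ | ⟨h2, h3, h4⟩
  · rw [h2, coroot_refl_self] at hs
    nlinarith [sq_nonneg (K.coroot i ν)]
  · exact ⟨_, _, h2, by rw [h3, h4], by rwa [h3]⟩

lemma sigmaStep_refl (hσ : 0 < σ) (h : K.coroot i ν < 0) {n : ℤ} (hn : σ * K.coroot i ν = n) :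
    K.SigmaStep σ ν (K.refl i ν) := by
  refine ⟨dist_refl_eq_one h, _, _, K.posRoot_simple i, rfl, n, ?_, hn⟩
  have : (σ : ℝ) * K.coroot i ν < 0 := mul_neg_of_pos_of_neg (by exact_mod_cast hσ) h
  rw [hn] at this
  exact_mod_cast this

variable (K σ) in
/-- Possibly trivial `σ`-chains. -/
abbrev WeakChain : V → V → Prop := Relation.ReflTransGen (K.SigmaStep σ)

lemma WeakChain.coroot_sub (h : K.WeakChain σ ν κ) (i : I) :
    ∃ n : ℤ, σ * K.coroot i κ = σ * K.coroot i ν + n := by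
  induction h with
  | refl => exact ⟨0, by simp⟩
  | tail _ h ih =>
    obtain ⟨n, hn⟩ := ih
    obtain ⟨m, hm⟩ := h.coroot_sub i
    exact ⟨n + m, by rw [hm, hn]; push_cast; ring⟩

lemma WeakChain.int_of_crossing (h : K.WeakChain σ ν κ) (hν : K.coroot i ν ≤ 0)
    (hκ : 0 ≤ K.coroot i κ) : ∃ n : ℤ, σ * K.coroot i ν = n := by
  induction h using Relation.ReflTransGen.head_induction_on with
  | refl => exact ⟨0, by simp [le_antisymm hν hκ]⟩
  | head h _ ih =>
    rename_i ν ξ _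
    rcases le_or_gt (K.coroot i ξ) 0 with h1 | h1
    · obtain ⟨n, hn⟩ := ih h1
      obtain ⟨m, hm⟩ := h.coroot_sub i
      exact ⟨n - m, by push_cast; linarith⟩
    · exact (h.crossing hν h1.le (by linarith)).2

lemma WeakChain.refl_left (h : K.WeakChain σ ν κ) (hν : K.coroot i ν < 0)
    (hκ : 0 ≤ K.coroot i κ) : K.WeakChain σ (K.refl i ν) κ := by
  induction h using Relation.ReflTransGen.head_induction_on with
  | refl => linarith
  | head h h' ih =>
    rename_i ν ξ
    rcases lt_or_ge (K.coroot i ξ) 0 with h1 | h1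
    · exact (ih h1).head (h.refl (mul_pos_of_neg_of_neg hν h1))
    · rw [← (h.crossing hν.le h1 (by linarith)).1]
      exact h'

lemma WeakChain.refl_right (h : K.WeakChain σ ν κ) (hν : K.coroot i ν ≤ 0)
    (hκ : 0 < K.coroot i κ) : K.WeakChain σ ν (K.refl i κ) := by
  induction h with
  | refl => linarith
  | tail h' h ih =>
    rename_i ξ κ
    rcases lt_or_ge 0 (K.coroot i ξ) with h1 | h1
    · exact (ih h1).tail (h.refl (mul_pos h1 hκ))
    · rw [(h.crossing h1 hκ.le (by linarith)).1, refl_refl]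
      exact h'

lemma WeakChain.refl_of_neg (h : K.WeakChain σ ν κ) (hν : K.coroot i ν < 0)
    (hint : ∀ n : ℤ, σ * K.coroot i ν ≠ n) : K.WeakChain σ (K.refl i ν) (K.refl i κ) := by
  induction h using Relation.ReflTransGen.head_induction_on with
  | refl => exact .refl
  | head h h' ih =>
    rename_i ν ξ
    rcases lt_or_ge (K.coroot i ξ) 0 with h1 | h1
    · refine (ih h1 fun n hn => ?_).head (h.refl (mul_pos_of_neg_of_neg hν h1))
      obtain ⟨m, hm⟩ := h.coroot_sub i
      exact hint (n - m) (by push_cast; linarith)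
    · obtain ⟨n, hn⟩ := (h.crossing hν.le h1 (by linarith)).2
      exact absurd hn (hint n)

lemma WeakChain.refl_of_pos (h : K.WeakChain σ ν κ) (hκ : 0 < K.coroot i κ)
    (hint : ∀ n : ℤ, σ * K.coroot i κ ≠ n) : K.WeakChain σ (K.refl i ν) (K.refl i κ) := by
  induction h with
  | refl => exact .refl
  | tail h' h ih =>
    rename_i ξ κ
    obtain ⟨m, hm⟩ := h.coroot_sub i
    rcases lt_or_ge 0 (K.coroot i ξ) with h1 | h1
    · refine (ih h1 fun n hn => ?_).tail (h.refl (mul_pos h1 hκ))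
      exact hint (n + m) (by push_cast; linarith)
    · obtain ⟨n, hn⟩ := (h.crossing h1 hκ.le (by linarith)).2
      exact absurd (by push_cast; linarith) (hint (n + m))

end SigmaSteps

section PiecewiseLinear

/-- `f` is the piecewise-linear path with breakpoints `τ 0 < ⋯ < τ s` and directions
`ν 0, …, ν (s - 1)`. -/
structure PiecewiseLinear (f : ℝ → V) (s : ℕ) (ν : ℕ → V) (τ : ℕ → ℚ) : Prop where
  zero : τ 0 = 0
  last : τ s = 1
  lt : ∀ k < s, τ k < τ (k + 1)
  left : ∀ t ≤ 0, f t = 0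
  right : ∀ t, 1 ≤ t → f t = f 1
  seg : ∀ k < s, ∀ t : ℝ, τ k ≤ t → t ≤ τ (k + 1) → f t = f (τ k) + (t - τ k) • ν k

variable {f g : ℝ → V} {s : ℕ} {ν : ℕ → V} {τ : ℕ → ℚ}

lemma le_of_lt_succ (hlt : ∀ k < s, τ k < τ (k + 1)) {j k : ℕ} (hjk : j ≤ k) (hk : k ≤ s) :
    τ j ≤ τ k := by
  induction k, hjk using Nat.le_induction with
  | base => exact le_rfl
  | succ k _ ih => exact (ih (by omega)).trans (hlt k (by omega)).le

lemma piecewiseLinear_sum (h0 : τ 0 = 0) (h1 : τ s = 1) (hlt : ∀ k < s, τ k < τ (k + 1)) :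
    PiecewiseLinear (fun t => ∑ k ∈ Finset.range s,
      (min t ((τ (k + 1) : ℚ) : ℝ) - min t ((τ k : ℚ) : ℝ)) • ν k) s ν τ := by
  have hmono : ∀ {j k : ℕ}, j ≤ k → k ≤ s → ((τ j : ℚ) : ℝ) ≤ τ k := fun h h' => by
    exact_mod_cast le_of_lt_succ hlt h h'
  refine ⟨h0, h1, hlt, fun t ht => ?_, fun t ht => ?_, fun k hk t hkt htk => ?_⟩
  · refine Finset.sum_eq_zero fun k hk => ?_
    have hk := Finset.mem_range.mp hk
    have h2 := hmono (Nat.zero_le k) hk.le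
    have h3 := hmono (Nat.zero_le (k + 1)) hk
    rw [h0, Rat.cast_zero] at h2 h3
    rw [min_eq_left (by linarith), min_eq_left (by linarith), sub_self, zero_smul]
  · refine Finset.sum_congr rfl fun k hk => ?_
    have hk := Finset.mem_range.mp hk
    have h2 := hmono hk.le le_rfl
    have h3 := hmono (show k + 1 ≤ s from hk) le_rfl
    rw [h1, Rat.cast_one] at h2 h3
    simp only [min_eq_right h2, min_eq_right h3, min_eq_right (h2.trans ht),
      min_eq_right (h3.trans ht)]
  · rw [← sub_eq_iff_eq_add', ← Finset.sum_sub_distrib, Finset.sum_eq_single k]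
    · have := hmono (Nat.le_succ k) hk
      rw [min_eq_left htk, min_eq_right hkt, min_eq_left this, min_self]
      module
    · intro j hj hjk
      have hj := Finset.mem_range.mp hj
      rcases Nat.lt_or_gt_of_ne hjk with h | h
      · have h2 := hmono (show j + 1 ≤ k from h) hk.le
        have h3 := hmono h.le hk.le
        rw [min_eq_right h2, min_eq_right h3, min_eq_right (h2.trans hkt),
          min_eq_right (h3.trans hkt), sub_self]
      · have h2 := hmono (show k + 1 ≤ j from h) hj.le
        have h3 := hmono (show k + 1 ≤ j + 1 by omega) hj
        rw [min_eq_left (htk.trans h2), min_eq_left (htk.trans h3),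
          min_eq_left ((hkt.trans htk).trans h2), min_eq_left ((hkt.trans htk).trans h3)]
        simp
    · intro h; exact absurd (Finset.mem_range.mpr hk) h

namespace PiecewiseLinear

lemma mono (h : PiecewiseLinear f s ν τ) {j k : ℕ} (hjk : j ≤ k) (hk : k ≤ s) : τ j ≤ τ k :=
  le_of_lt_succ h.lt hjk hk

lemma cast_mono (h : PiecewiseLinear f s ν τ) {j k : ℕ} (hjk : j ≤ k) (hk : k ≤ s) :
    ((τ j : ℚ) : ℝ) ≤ τ k := by exact_mod_cast h.mono hjk hk

lemma cast_lt (h : PiecewiseLinear f s ν τ) {k : ℕ} (hk : k < s) :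
    ((τ k : ℚ) : ℝ) < τ (k + 1) := by exact_mod_cast h.lt k hk

lemma cast_strictMono (h : PiecewiseLinear f s ν τ) {j k : ℕ} (hjk : j < k) (hk : k ≤ s) :
    ((τ j : ℚ) : ℝ) < τ k :=
  (h.cast_lt (hjk.trans_le hk)).trans_le (h.cast_mono hjk hk)

lemma lt_of_cast_lt (h : PiecewiseLinear f s ν τ) {j k : ℕ} (hj : j ≤ s)
    (hlt : ((τ j : ℚ) : ℝ) < τ k) : j < k := by
  by_contra! hk
  exact absurd (h.cast_mono hk hj) (not_le.mpr hlt)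

lemma cast_zero (h : PiecewiseLinear f s ν τ) : ((τ 0 : ℚ) : ℝ) = 0 := by simp [h.zero]

lemma cast_last (h : PiecewiseLinear f s ν τ) : ((τ s : ℚ) : ℝ) = 1 := by simp [h.last]

lemma cast_nonneg (h : PiecewiseLinear f s ν τ) {k : ℕ} (hk : k ≤ s) : 0 ≤ ((τ k : ℚ) : ℝ) := by
  rw [← h.cast_zero]; exact h.cast_mono (Nat.zero_le k) hk

lemma cast_le_one (h : PiecewiseLinear f s ν τ) {k : ℕ} (hk : k ≤ s) : ((τ k : ℚ) : ℝ) ≤ 1 := by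
  rw [← h.cast_last]; exact h.cast_mono hk le_rfl

lemma exists_lt_le (h : PiecewiseLinear f s ν τ) {t : ℝ} (h0 : 0 < t) (h1 : t ≤ 1) :
    ∃ k < s, τ k < t ∧ t ≤ τ (k + 1) := by
  suffices ∀ n ≤ s, t ≤ τ n → ∃ k < s, τ k < t ∧ t ≤ τ (k + 1) from
    this s le_rfl (by rwa [h.cast_last])
  intro n hn ht
  induction n with
  | zero => rw [h.cast_zero] at ht; linarith
  | succ n ih =>
    rcases le_or_gt t (τ n) with h2 | h2
    · exact ih (by omega) h2
    · exact ⟨n, hn, h2, ht⟩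

lemma exists_le_lt (h : PiecewiseLinear f s ν τ) {t : ℝ} (h0 : 0 ≤ t) (h1 : t < 1) :
    ∃ k < s, τ k ≤ t ∧ t < τ (k + 1) := by
  suffices ∀ n ≤ s, t < τ n → ∃ k < s, τ k ≤ t ∧ t < τ (k + 1) from
    this s le_rfl (by rwa [h.cast_last])
  intro n hn ht
  induction n with
  | zero => rw [h.cast_zero] at ht; linarith
  | succ n ih =>
    rcases lt_or_ge t (τ n) with h2 | h2
    · exact ih (by omega) h2
    · exact ⟨n, hn, h2, ht⟩

lemma unique (hf : PiecewiseLinear f s ν τ) (hg : PiecewiseLinear g s ν τ) : f = g := by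
  have key : ∀ k ≤ s, ∀ t : ℝ, t ≤ τ k → f t = g t := by
    intro k hk
    induction k with
    | zero => intro t ht; rw [hf.cast_zero] at ht; rw [hf.left t ht, hg.left t ht]
    | succ k ih =>
      intro t ht
      rcases le_total t (τ k) with h | h
      · exact ih (by omega) t h
      · rw [hf.seg k hk t h ht, hg.seg k hk t h ht, ih (by omega) _ le_rfl]
  funext t
  rcases le_total t 1 with h | h
  · exact key s le_rfl t (by rwa [hf.cast_last])
  · rw [hf.right t h, hg.right t h, key s le_rfl 1 hf.cast_last.ge]

lemma eq_sum (hf : PiecewiseLinear f s ν τ) : f = fun t => ∑ k ∈ Finset.range s,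
    (min t ((τ (k + 1) : ℚ) : ℝ) - min t ((τ k : ℚ) : ℝ)) • ν k :=
  hf.unique (piecewiseLinear_sum hf.zero hf.last hf.lt)

lemma continuous_comp (hf : PiecewiseLinear f s ν τ) (φ : V →ₗ[ℝ] ℝ) :
    Continuous fun t => φ (f t) := by
  rw [hf.eq_sum]
  simp only [map_sum, map_smul, smul_eq_mul]
  fun_prop

/-- Two consecutive pieces with the same direction may be merged. -/
lemma merge (hf : PiecewiseLinear f (s + 1) ν τ) {u : ℕ} (hu : u < s) (heq : ν u = ν (u + 1)) :
    PiecewiseLinear f s (fun k => if k ≤ u then ν k else ν (k + 1))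
      (fun k => if k ≤ u then τ k else τ (k + 1)) := by
  refine ⟨by simp [hf.zero], by simp [hu, hf.last], fun k hk => ?_, hf.left, hf.right,
    fun k hk t h1 h2 => ?_⟩
  · rcases lt_trichotomy k u with h | rfl | h
    · simpa [h.le, Nat.succ_le_of_lt h] using hf.lt k (by omega)
    · simpa using (hf.lt k (by omega)).trans (hf.lt (k + 1) (by omega))
    · simpa [not_le.mpr h, not_lt.mpr h.le] using hf.lt (k + 1) (by omega)
  · rcases lt_trichotomy k u with h | rfl | h
    · simp only [h.le, Nat.succ_le_of_lt h, if_true] at h1 h2 ⊢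
      exact hf.seg k (by omega) t h1 h2
    · simp only [le_refl, if_true, Nat.not_succ_le_self, if_false] at h1 h2 ⊢
      rcases le_total t (τ (k + 1)) with h | h
      · exact hf.seg k (by omega) t h1 h
      · rw [hf.seg (k + 1) (by omega) t h h2,
          hf.seg k (by omega) _ (hf.cast_lt (by omega)).le le_rfl, heq]
        module
    · simp only [not_le.mpr h, not_le.mpr (h.trans (Nat.lt_succ_self k)), if_false] at h1 h2 ⊢
      exact hf.seg (k + 1) (by omega) t h1 h2

/-- A breakpoint may be inserted into a piece. -/
lemma insert (hf : PiecewiseLinear f s ν τ) {u : ℕ} (hu : u < s) {c : ℚ} (h1 : τ u < c)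
    (h2 : c < τ (u + 1)) :
    PiecewiseLinear f (s + 1) (fun k => if k ≤ u then ν k else ν (k - 1))
      (fun k => if k ≤ u then τ k else if k = u + 1 then c else τ (k - 1)) := by
  have hc1 : ((τ u : ℚ) : ℝ) < c := by exact_mod_cast h1
  have hc2 : (c : ℝ) < τ (u + 1) := by exact_mod_cast h2
  have hs0 : s ≠ u := by omega
  have hsu : ¬ s + 1 ≤ u := by omega
  refine ⟨by simp [hf.zero], by simp [hs0, hsu, hf.last], fun k hk => ?_, hf.left, hf.right,
    fun k hk t h3 h4 => ?_⟩
  · rcases lt_trichotomy k u with h | rfl | h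
    · simpa [h.le, Nat.succ_le_of_lt h] using hf.lt k (by omega)
    · simpa using h1
    · rcases Nat.eq_or_lt_of_le (show u + 1 ≤ k from h) with rfl | h'
      · simpa using h2
      · obtain ⟨j, rfl⟩ : ∃ j, k = j + 1 := ⟨k - 1, by omega⟩
        have e1 : ¬ j + 1 ≤ u := by omega
        have e2 : ¬ j + 1 + 1 ≤ u := by omega
        have e3 : ¬ j = u := by omega
        have e4 : ¬ j + 1 = u := by omega
        simpa [e1, e2, e3, e4] using hf.lt j (by omega)
  · rcases lt_trichotomy k u with h | rfl | h
    · simp only [h.le, Nat.succ_le_of_lt h, if_true] at h3 h4 ⊢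
      exact hf.seg k (by omega) t h3 h4
    · simp only [le_refl, if_true, Nat.not_succ_le_self, if_false] at h3 h4 ⊢
      exact hf.seg k (by omega) t h3 (h4.trans hc2.le)
    · rcases Nat.eq_or_lt_of_le (show u + 1 ≤ k from h) with rfl | h'
      · simp at h3 h4 ⊢
        rw [hf.seg u hu t (hc1.le.trans h3) h4, hf.seg u hu c hc1.le hc2.le]
        module
      · obtain ⟨j, rfl⟩ : ∃ j, k = j + 1 := ⟨k - 1, by omega⟩
        have e1 : ¬ j + 1 ≤ u := by omega
        have e2 : ¬ j + 1 + 1 ≤ u := by omega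
        have e3 : ¬ j = u := by omega
        have e4 : ¬ j + 1 = u := by omega
        simp [e1, e2, e3, e4] at h3 h4 ⊢
        exact hf.seg j (by omega) t h3 h4

end PiecewiseLinear

end PiecewiseLinear

section WeakLS

/-- LS paths presented with possibly redundant breakpoints. -/
structure WeakLS (μ : V) (f : ℝ → V) (s : ℕ) (ν : ℕ → V) (τ : ℕ → ℚ) : Prop
    extends PiecewiseLinear f s ν τ where
  mem : ∀ k < s, ν k ∈ K.orbit μ
  chain : ∀ k, k + 1 < s → K.WeakChain (τ (k + 1)) (ν k) (ν (k + 1))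

variable {K} {μ : V} {f : ℝ → V} {s : ℕ} {ν : ℕ → V} {τ : ℕ → ℚ} {i : I}

lemma exists_weakLS (hf : f ∈ K.B μ) : ∃ s ν τ, K.WeakLS μ f s ν τ := by
  obtain ⟨π, rfl⟩ := hf
  let ν : ℕ → V := fun k => if h : k < π.s then π.ν ⟨k, h⟩ else 0
  let τ : ℕ → ℚ := fun k => if h : k < π.s + 1 then π.τ ⟨k, h⟩ else 0
  have hpath : π.path = fun t => ∑ k ∈ Finset.range π.s,
      (min t ((τ (k + 1) : ℚ) : ℝ) - min t ((τ k : ℚ) : ℝ)) • ν k := by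
    funext t
    rw [Finset.sum_range]
    refine Finset.sum_congr rfl fun k _ => ?_
    have hk := k.isLt
    simp [ν, τ]
    rfl
  refine ⟨π.s, ν, τ, ?_, fun k hk => ?_, fun k hk => ?_⟩
  · rw [hpath]
    refine piecewiseLinear_sum ?_ ?_ fun k hk => ?_
    · simpa [τ] using π.τ_zero
    · simpa [τ, Fin.last] using π.τ_last
    · have h1 : k < π.s + 1 := by omega
      simpa [τ, hk.le, hk] using π.τ_mono (a := ⟨k, h1⟩) (b := ⟨k + 1, by omega⟩) (by simp)
  · simpa [ν, hk] using π.mem ⟨k, hk⟩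
  · have h1 : k < π.s := by omega
    have := sigmaChain_iff.mp (π.chainCond k hk)
    simpa [ν, τ, hk, h1] using this.to_reflTransGen

lemma WeakLS.mem_B (hf : K.WeakLS μ f s ν τ) : f ∈ K.B μ := by
  induction s generalizing ν τ with
  | zero =>
    have := hf.zero.symm.trans hf.last
    norm_num at this
  | succ s ih =>
    by_cases hex : ∃ u < s, ν u = ν (u + 1)
    · obtain ⟨u, hu, heq⟩ := hex
      refine ih ⟨hf.merge hu heq, fun k hk => ?_, fun k hk => ?_⟩
      · split_ifs
        · exact hf.mem k (by omega)
        · exact hf.mem (k + 1) (by omega)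
      · rcases lt_trichotomy k u with h | rfl | h
        · simpa [h.le, Nat.succ_le_of_lt h] using hf.chain k (by omega)
        · simpa [heq] using hf.chain (k + 1) (by omega)
        · simpa [not_le.mpr h, not_lt.mpr h.le] using hf.chain (k + 1) (by omega)
    · push Not at hex
      have hchain : ∀ k, k + 1 < s + 1 →
          Relation.TransGen (K.SigmaStep (τ (k + 1))) (ν k) (ν (k + 1)) := fun k hk => by
        rcases Relation.reflTransGen_iff_eq_or_transGen.mp (hf.chain k hk) with h | h
        · exact absurd h.symm (hex k (by omega))
        · exact h
      let π : K.LSData μ :=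
        { s := s + 1
          spos := Nat.succ_pos s
          ν := fun k => ν k
          τ := fun k => τ k
          mem := fun k => hf.mem k k.isLt
          strictDec := fun k hk => Relation.TransGen.mono (fun _ _ h => SigmaStep.stepDown h) _ _ (hchain k hk)
          τ_zero := hf.zero
          τ_last := by simpa using hf.last
          τ_mono := by
            rw [Fin.strictMono_iff_lt_succ]
            intro k
            simpa using hf.lt k k.isLt
          chainCond := fun k hk => sigmaChain_iff.mpr (hchain k hk) }
      refine ⟨π, ?_⟩
      rw [hf.eq_sum]
      funext t
      rw [Finset.sum_range]
      simp [LSData.path, π]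

lemma WeakLS.exists_insert (hf : K.WeakLS μ f s ν τ) {c : ℚ} (h0 : 0 ≤ c) (h1 : c ≤ 1) :
    ∃ s' ν' τ', K.WeakLS μ f s' ν' τ' ∧ (∃ a ≤ s', τ' a = c) ∧
      ∀ k ≤ s, ∃ k' ≤ s', τ' k' = τ k := by
  by_cases hex : ∃ a ≤ s, τ a = c
  · exact ⟨s, ν, τ, hf, hex, fun k hk => ⟨k, hk, rfl⟩⟩
  push Not at hex
  have hc0 : 0 < c := lt_of_le_of_ne h0 fun h => hex 0 (Nat.zero_le s) (hf.zero.trans h)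
  obtain ⟨u, hu, h2, h3⟩ := hf.exists_lt_le (t := c) (by exact_mod_cast hc0)
    (by exact_mod_cast h1)
  have h2 : τ u < c := by exact_mod_cast h2
  have h3 : c ≤ τ (u + 1) := by exact_mod_cast h3
  have h3 : c < τ (u + 1) := lt_of_le_of_ne h3 (hex (u + 1) hu).symm
  refine ⟨s + 1, _, _, ⟨hf.insert hu h2 h3, fun k hk => ?_, fun k hk => ?_⟩,
    ⟨u + 1, by omega, by simp⟩, fun k hk => ?_⟩
  · split_ifs
    · exact hf.mem k (by omega)
    · exact hf.mem (k - 1) (by omega)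
  · rcases lt_trichotomy k u with h | rfl | h
    · simpa [h.le, Nat.succ_le_of_lt h] using hf.chain k (by omega)
    · simpa using Relation.ReflTransGen.refl
    · obtain ⟨j, rfl⟩ : ∃ j, k = j + 1 := ⟨k - 1, by omega⟩
      have e1 : ¬ j + 1 ≤ u := by omega
      have e2 : ¬ j + 1 + 1 ≤ u := by omega
      have e3 : ¬ j + 1 = u := by omega
      simpa [e1, e2, e3] using hf.chain j (by omega)
  · rcases le_or_gt k u with h | h
    · exact ⟨k, by omega, by simp [h]⟩
    · have e1 : ¬ k + 1 ≤ u := by omega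
      have e2 : ¬ k = u := by omega
      exact ⟨k + 1, by omega, by simp [e1, e2]⟩

namespace WeakLS

lemma H_seg (hf : K.WeakLS μ f s ν τ) (i : I) {k : ℕ} (hk : k < s) {t : ℝ} (h1 : τ k ≤ t)
    (h2 : t ≤ τ (k + 1)) :
    K.H i f t = K.H i f (τ k) + (t - τ k) * K.coroot i (ν k) := by
  simp only [H]
  rw [hf.seg k hk t h1 h2, map_add, map_smul, smul_eq_mul]

lemma H_seg_sub (hf : K.WeakLS μ f s ν τ) (i : I) {k : ℕ} (hk : k < s) {t t' : ℝ}
    (h1 : τ k ≤ t) (h2 : t ≤ τ (k + 1)) (h1' : τ k ≤ t') (h2' : t' ≤ τ (k + 1)) :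
    K.H i f t' - K.H i f t = (t' - t) * K.coroot i (ν k) := by
  rw [hf.H_seg i hk h1 h2, hf.H_seg i hk h1' h2']; ring

lemma H_zero (hf : K.WeakLS μ f s ν τ) (i : I) : K.H i f 0 = 0 := by
  simp [H, hf.left 0 le_rfl]

lemma continuous_H (hf : K.WeakLS μ f s ν τ) (i : I) : Continuous (K.H i f) :=
  hf.continuous_comp (K.coroot i)

/-- Along the `k`-th piece, `H_i(t)` agrees with `t ⟨ν_k, α_i∨⟩` modulo `ℤ`. -/
lemma H_mod_int (hf : K.WeakLS μ f s ν τ) (i : I) {k : ℕ} (hk : k < s) {t : ℝ} (h1 : τ k ≤ t)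
    (h2 : t ≤ τ (k + 1)) : ∃ n : ℤ, K.H i f t = t * K.coroot i (ν k) + n := by
  induction k generalizing t with
  | zero =>
    refine ⟨0, ?_⟩
    rw [hf.H_seg i hk h1 h2, hf.cast_zero, hf.H_zero]
    simp
  | succ k ih =>
    obtain ⟨n, hn⟩ := ih (by omega) (hf.cast_lt (by omega)).le le_rfl
    obtain ⟨m, hm⟩ := (hf.chain k hk).coroot_sub i
    refine ⟨n - m, ?_⟩
    rw [hf.H_seg i hk h1 h2, hn]
    push_cast
    linarith

lemma exists_int_slope (hμ : μ ∈ K.P) (hf : K.WeakLS μ f s ν τ) (i : I) {k : ℕ} (hk : k < s) :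
    ∃ n : ℤ, K.coroot i (ν k) = n :=
  K.pairingInt i _ (orbit_subset_P hμ (hf.mem k hk))

lemma exists_rat (hμ : μ ∈ K.P) (hf : K.WeakLS μ f s ν τ) {k : ℕ} (hk : k < s) {t : ℝ}
    (h1 : τ k ≤ t) (h2 : t ≤ τ (k + 1)) (hne : K.coroot i (ν k) ≠ 0) {n : ℤ}
    (hn : K.H i f t = n) : ∃ c : ℚ, (c : ℝ) = t := by
  obtain ⟨m, hm⟩ := hf.H_mod_int i hk h1 h2
  obtain ⟨N, hN⟩ := hf.exists_int_slope hμ i hk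
  refine ⟨(n - m) / N, ?_⟩
  rw [hN] at hne hm
  push_cast
  rw [div_eq_iff hne]
  linarith

lemma H_int_of_crossing (hf : K.WeakLS μ f s ν τ) {k : ℕ} (hk : k + 1 < s)
    (h1 : K.coroot i (ν k) ≤ 0) (h2 : 0 ≤ K.coroot i (ν (k + 1))) :
    ∃ n : ℤ, K.H i f (τ (k + 1)) = n := by
  obtain ⟨n, hn⟩ := (hf.chain k hk).int_of_crossing h1 h2
  obtain ⟨m, hm⟩ := hf.H_mod_int i (k := k) (by omega) (hf.cast_lt (by omega)).le le_rfl
  exact ⟨n + m, by rw [hm, hn]; push_cast; ring⟩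

lemma slope_nonpos (hf : K.WeakLS μ f s ν τ) {k : ℕ} (hk : k < s) {t t' : ℝ} (h1 : τ k ≤ t)
    (hlt : t < t') (h2 : t' ≤ τ (k + 1)) (hH : K.H i f t' ≤ K.H i f t) :
    K.coroot i (ν k) ≤ 0 := by
  have := hf.H_seg_sub i hk h1 (hlt.le.trans h2) (h1.trans hlt.le) h2
  by_contra! h
  have := mul_pos (sub_pos.mpr hlt) h
  linarith

lemma slope_nonneg (hf : K.WeakLS μ f s ν τ) {k : ℕ} (hk : k < s) {t t' : ℝ} (h1 : τ k ≤ t)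
    (hlt : t < t') (h2 : t' ≤ τ (k + 1)) (hH : K.H i f t ≤ K.H i f t') :
    0 ≤ K.coroot i (ν k) := by
  have := hf.H_seg_sub i hk h1 (hlt.le.trans h2) (h1.trans hlt.le) h2
  by_contra! h
  have := mul_neg_of_pos_of_neg (sub_pos.mpr hlt) h
  linarith

lemma slope_ne_zero (hf : K.WeakLS μ f s ν τ) {k : ℕ} (hk : k < s) {t t' : ℝ} (h1 : τ k ≤ t)
    (hlt : t < t') (h2 : t' ≤ τ (k + 1)) (hH : K.H i f t ≠ K.H i f t') :
    K.coroot i (ν k) ≠ 0 := by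
  have := hf.H_seg_sub i hk h1 (hlt.le.trans h2) (h1.trans hlt.le) h2
  intro h
  rw [h, mul_zero, sub_eq_zero] at this
  exact hH this.symm

/-- The minimum of `H_i` is an integer. -/
lemma H_int_of_min (hμ : μ ∈ K.P) (hf : K.WeakLS μ f s ν τ) {t : ℝ} (ht : t ∈ Set.Icc (0 : ℝ) 1)
    (hmin : ∀ t' ∈ Set.Icc (0 : ℝ) 1, K.H i f t ≤ K.H i f t') : ∃ n : ℤ, K.H i f t = n := by
  rcases ht.1.eq_or_lt with rfl | h0
  · exact ⟨0, by simp [hf.H_zero]⟩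
  obtain ⟨k, hk, h1, h2⟩ := hf.exists_lt_le h0 ht.2
  have hmin' : ∀ j ≤ s, K.H i f t ≤ K.H i f (τ j) := fun j hj =>
    hmin _ ⟨hf.cast_nonneg hj, hf.cast_le_one hj⟩
  have hk1 : K.coroot i (ν k) ≤ 0 := hf.slope_nonpos hk le_rfl h1 h2 (hmin' k hk.le)
  obtain ⟨n, hn⟩ := hf.H_mod_int i hk h1.le h2
  rcases h2.lt_or_eq with h3 | h3
  · have hk2 := hf.slope_nonneg hk h1.le h3 le_rfl (hmin' (k + 1) hk)
    exact ⟨n, by rw [hn, le_antisymm hk1 hk2]; simp⟩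
  rcases Nat.eq_or_lt_of_le (show k + 1 ≤ s from hk) with hks | hks
  · obtain ⟨m, hm⟩ := hf.exists_int_slope hμ i hk
    refine ⟨m + n, ?_⟩
    rw [hn, h3, hks, hf.cast_last, hm]
    push_cast; ring
  · have hk2 := hf.slope_nonneg hks h3.ge (h3.trans_lt (hf.cast_lt hks)) le_rfl
      (hmin' (k + 1 + 1) hks)
    rw [h3]
    exact hf.H_int_of_crossing hks hk1 hk2

lemma not_int_of_mem_Ioo {x : ℝ} {m : ℤ} (h1 : (m : ℝ) < x) (h2 : x < m + 1) (n : ℤ) :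
    x ≠ n := by
  rintro rfl
  have h1 : m < n := by exact_mod_cast h1
  have h2 : n < m + 1 := by exact_mod_cast h2
  omega

lemma slope_neg_of_Ioo (hf : K.WeakLS μ f s ν τ) {a b : ℕ} (hb : b ≤ s) {m : ℤ}
    (ha : K.H i f (τ a) = m + 1)
    (hI : ∀ t : ℝ, τ a < t → t < τ b → m < K.H i f t ∧ K.H i f t < m + 1) (k : ℕ) (hak : a ≤ k)
    (hkb : k < b) : K.coroot i (ν k) < 0 := by
  induction k, hak using Nat.le_induction with
  | base =>
    obtain ⟨t, h1, h2⟩ := exists_between (hf.cast_lt (show a < s by omega))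
    have hlt : K.H i f t < K.H i f (τ a) := by
      rw [ha]
      exact (hI t h1 (h2.trans_le (hf.cast_mono (by omega) hb))).2
    exact lt_of_le_of_ne (hf.slope_nonpos (by omega) le_rfl h1 h2.le hlt.le)
      (hf.slope_ne_zero (by omega) le_rfl h1 h2.le hlt.ne')
  | succ k hak ih =>
    obtain ⟨h1, h2⟩ := hI (τ (k + 1)) (hf.cast_strictMono (by omega) (by omega))
      (hf.cast_strictMono hkb hb)
    by_contra! h3
    obtain ⟨n, hn⟩ := hf.H_int_of_crossing (by omega) (ih (by omega)).le h3
    exact not_int_of_mem_Ioo h1 h2 n hn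

lemma slope_pos_of_Ioo (hf : K.WeakLS μ f s ν τ) {a b : ℕ} (hb : b ≤ s) {m : ℤ}
    (hHb : K.H i f (τ b) = m + 1)
    (hI : ∀ t : ℝ, τ a < t → t < τ b → m < K.H i f t ∧ K.H i f t < m + 1) (k : ℕ) (hak : a ≤ k)
    (hkb : k < b) : 0 < K.coroot i (ν k) := by
  obtain ⟨b, rfl⟩ : ∃ c, b = c + 1 := ⟨b - 1, by omega⟩
  have hkb : k ≤ b := by omega
  induction hkb using Nat.decreasingInduction with
  | self =>
    obtain ⟨t, h1, h2⟩ := exists_between (hf.cast_lt (show b < s by omega))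
    have hlt : K.H i f t < K.H i f (τ (b + 1)) := by
      rw [hHb]
      exact (hI t ((hf.cast_mono hak (by omega)).trans_lt h1) h2).2
    exact lt_of_le_of_ne (hf.slope_nonneg (by omega) h1.le h2 le_rfl hlt.le)
      (hf.slope_ne_zero (by omega) h1.le h2 le_rfl hlt.ne).symm
  | of_succ k hkb ih =>
    obtain ⟨h1, h2⟩ := hI (τ (k + 1)) (hf.cast_strictMono (by omega) (by omega))
      (hf.cast_strictMono (by omega) hb)
    by_contra! h3
    obtain ⟨n, hn⟩ := hf.H_int_of_crossing (by omega) h3 (ih (by omega) (by omega)).le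
    exact not_int_of_mem_Ioo h1 h2 n hn

/-- Reflecting a monotone stretch of `H_i` between two breakpoints of integral height. -/
theorem reflect (hf : K.WeakLS μ f s ν τ) {a b : ℕ} (hab : a < b) (hb : b ≤ s) {g : ℝ → V}
    (hsign : (∀ k, a ≤ k → k < b → K.coroot i (ν k) < 0) ∨
      ∀ k, a ≤ k → k < b → 0 < K.coroot i (ν k))
    (hint : ∀ k, a < k → k < b → ∀ n : ℤ, K.H i f (τ k) ≠ n)
    (ha : ∃ n : ℤ, K.H i f (τ a) = n) (hHb : ∃ n : ℤ, K.H i f (τ b) = n)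
    (hleft : K.coroot i (ν a) < 0 ∨ ∀ k, k + 1 = a → K.coroot i (ν k) ≤ 0)
    (hright : (∀ k, k + 1 = b → 0 < K.coroot i (ν k)) ∨ (b < s → 0 ≤ K.coroot i (ν b)))
    (hg1 : ∀ t : ℝ, t ≤ τ a → g t = f t)
    (hg2 : ∀ t : ℝ, τ a ≤ t → t ≤ τ b → g t = K.refl i (f t - f (τ a)) + f (τ a))
    {δ : V} (hg3 : ∀ t : ℝ, τ b ≤ t → g t = f t + δ) :
    K.WeakLS μ g s (fun k => if a ≤ k ∧ k < b then K.refl i (ν k) else ν k) τ := by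
  have ha0 := hf.cast_nonneg (show a ≤ s by omega)
  have hb1 := hf.cast_le_one hb
  have hτpos : ∀ k, k + 1 ≤ s → 0 < τ (k + 1) := fun k hk => by
    have := hf.cast_strictMono (Nat.succ_pos k) hk
    rw [hf.cast_zero] at this
    exact_mod_cast this
  have hslope : ∀ k, k + 1 ≤ s → ∃ n : ℤ,
      K.H i f (τ (k + 1)) = τ (k + 1) * K.coroot i (ν k) + n := fun k hk =>
    hf.H_mod_int i hk (hf.cast_lt hk).le le_rfl
  refine ⟨⟨hf.zero, hf.last, hf.lt, fun t ht => ?_, fun t ht => ?_, fun k hk t h1 h2 => ?_⟩,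
    fun k hk => ?_, fun k hk => ?_⟩
  · rw [hg1 t (ht.trans ha0), hf.left t ht]
  · rw [hg3 t (hb1.trans ht), hg3 1 hb1, hf.right t ht]
  · have hkt := hf.cast_lt hk
    have hseg := hf.seg k hk t h1 h2
    rcases lt_or_ge k a with hka | hka
    · have := hf.cast_mono (show k + 1 ≤ a from hka) (by omega)
      rw [if_neg (by omega), hg1 t (h2.trans this), hg1 _ (hkt.le.trans this)]
      exact hseg
    rcases lt_or_ge k b with hkb | hkb
    · have h3 := hf.cast_mono (show k + 1 ≤ b from hkb) hb
      have h4 := hf.cast_mono hka hk.le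
      rw [if_pos ⟨hka, hkb⟩, hg2 t (h4.trans h1) (h2.trans h3), hg2 _ h4 (hkt.le.trans h3), hseg]
      simp only [map_sub, map_add, map_smul]
      abel
    · have := hf.cast_mono hkb hk.le
      rw [if_neg (by omega), hg3 t (this.trans h1), hg3 _ this, hseg]
      abel
  · split_ifs
    · exact refl_mem_orbit (hf.mem k hk) i
    · exact hf.mem k hk
  · have hc := hf.chain k hk
    by_cases h1 : a ≤ k ∧ k < b <;> by_cases h2 : a ≤ k + 1 ∧ k + 1 < b <;>
      simp only [h1, h2, if_false] <;> (try simp only [and_self, if_true])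
    · have hne := hint (k + 1) (by omega) h2.2
      obtain ⟨n, hn⟩ := hslope k (by omega)
      obtain ⟨m, hm⟩ := hc.coroot_sub i
      rcases hsign with h | h
      · refine hc.refl_of_neg (h k h1.1 h1.2) fun n' h' => hne (n' + n) ?_
        rw [hn, h']; push_cast; ring
      · refine hc.refl_of_pos (h _ h2.1 h2.2) fun n' h' => hne (n' - m + n) ?_
        rw [hn]; push_cast; linarith
    · have hkb : k + 1 = b := by omega
      subst hkb
      by_cases hpos : 0 < K.coroot i (ν k)
      · obtain ⟨n, hn⟩ := hslope k (by omega)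
        obtain ⟨m, hm⟩ := hHb
        have hs : K.SigmaStep (τ (k + 1)) (K.refl i (ν k)) (K.refl i (K.refl i (ν k))) := by
          refine sigmaStep_refl (hτpos k (by omega)) (by rw [coroot_refl_self]; linarith)
            (n := n - m) ?_
          rw [coroot_refl_self]; push_cast; linarith
        rw [refl_refl] at hs
        exact hc.head hs
      · have hneg : K.coroot i (ν k) < 0 := by
          rcases hsign with h | h
          · exact h k h1.1 h1.2
          · exact absurd (h k h1.1 h1.2) hpos
        rcases hright with h | h
        · exact absurd (h k rfl) hpos
        · exact hc.refl_left hneg (h hk)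
    · have hka : k + 1 = a := by omega
      subst hka
      by_cases hneg : K.coroot i (ν (k + 1)) < 0
      · obtain ⟨n, hn⟩ := hf.H_mod_int i hk le_rfl (hf.cast_lt hk).le
        obtain ⟨m, hm⟩ := ha
        refine hc.tail (sigmaStep_refl (hτpos k (by omega)) hneg (n := m - n) ?_)
        push_cast; linarith
      · have hpos : 0 < K.coroot i (ν (k + 1)) := by
          rcases hsign with h | h
          · exact absurd (h _ h2.1 h2.2) hneg
          · exact h _ h2.1 h2.2
        rcases hleft with h | h
        · exact absurd h hneg
        · exact hc.refl_right (h k rfl) hpos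
    · exact hc

/-- Breakpoints may be added so that two given rational times occur among them. -/
lemma exists_insert_two (hf : K.WeakLS μ f s ν τ) {c d : ℝ} (hc : c ∈ Set.Icc (0 : ℝ) 1)
    (hd : d ∈ Set.Icc (0 : ℝ) 1) (hcr : ∃ q : ℚ, (q : ℝ) = c) (hdr : ∃ q : ℚ, (q : ℝ) = d) :
    ∃ s' ν' τ', K.WeakLS μ f s' ν' τ' ∧ ∃ a ≤ s', ∃ b ≤ s', (τ' a : ℝ) = c ∧ (τ' b : ℝ) = d := by
  obtain ⟨p, rfl⟩ := hcr
  obtain ⟨q, rfl⟩ := hdr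
  obtain ⟨s₁, ν₁, τ₁, h₁, ⟨a, ha, hτa⟩, -⟩ := hf.exists_insert (c := p)
    (by exact_mod_cast hc.1) (by exact_mod_cast hc.2)
  obtain ⟨s₂, ν₂, τ₂, h₂, ⟨b, hb, hτb⟩, h₃⟩ := h₁.exists_insert (c := q)
    (by exact_mod_cast hd.1) (by exact_mod_cast hd.2)
  obtain ⟨a', ha', hτa'⟩ := h₃ a ha
  exact ⟨s₂, ν₂, τ₂, h₂, a', ha', b, hb, by rw [hτa', hτa], by rw [hτb]⟩

lemma exists_isLeast_mval (hf : K.WeakLS μ f s ν τ) (i : I) :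
    (∃ t ∈ Set.Icc (0 : ℝ) 1, K.H i f t = K.mval i f) ∧
      ∀ t ∈ Set.Icc (0 : ℝ) 1, K.mval i f ≤ K.H i f t := by
  have hcomp : IsCompact (K.H i f '' Set.Icc 0 1) := isCompact_Icc.image (hf.continuous_H i)
  have hne : (K.H i f '' Set.Icc 0 1).Nonempty := (Set.nonempty_Icc.mpr zero_le_one).image _
  refine ⟨hcomp.sInf_mem hne, fun t ht => csInf_le hcomp.bddBelow ⟨t, ht, rfl⟩⟩

theorem eraw_mem_B (hμ : μ ∈ K.P) (hf : K.WeakLS μ f s ν τ) (hm : K.mval i f ≤ -1) :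
    K.eraw i f ∈ K.B μ := by
  obtain ⟨hex, hmin⟩ := hf.exists_isLeast_mval i
  have hcont := hf.continuous_H i
  obtain ⟨m, hmm⟩ : ∃ m : ℤ, K.mval i f = m := by
    obtain ⟨t, ht, htm⟩ := hex
    rw [← htm]
    exact hf.H_int_of_min hμ ht fun t' ht' => htm ▸ hmin t' ht'
  set S₁ := {t | t ∈ Set.Icc (0 : ℝ) 1 ∧ K.H i f t = K.mval i f}
  set t₁ := sInf S₁
  have hl : IsLeast S₁ t₁ := by
    have hcl : IsClosed S₁ := isClosed_Icc.inter (isClosed_eq hcont continuous_const)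
    have hbdd : BddBelow S₁ := ⟨0, fun t ht => ht.1.1⟩
    exact ⟨hcl.csInf_mem hex hbdd, fun t ht => csInf_le hbdd ht⟩
  set S₀ := {t | t ∈ Set.Icc (0 : ℝ) t₁ ∧ K.H i f t = K.mval i f + 1}
  set t₀ := sSup S₀
  obtain ⟨⟨⟨h10, h11⟩, h1m⟩, hleast⟩ := hl
  have hg : IsGreatest S₀ t₀ := by
    have hcl : IsClosed S₀ := isClosed_Icc.inter (isClosed_eq hcont continuous_const)
    have hbdd : BddAbove S₀ := ⟨t₁, fun t ht => ht.1.2⟩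
    have hne : S₀.Nonempty := by
      obtain ⟨t, ht, htm⟩ := intermediate_value_Icc' h10 hcont.continuousOn
        (show K.mval i f + 1 ∈ Set.Icc (K.H i f t₁) (K.H i f 0) by
          rw [h1m, hf.H_zero]; constructor <;> linarith)
      exact ⟨t, ht, htm⟩
    exact ⟨hcl.csSup_mem hne hbdd, fun t ht => le_csSup hbdd ht⟩
  obtain ⟨⟨⟨h00, h01⟩, h0m⟩, hgreat⟩ := hg
  have hlt : t₀ < t₁ := lt_of_le_of_ne h01 fun h => by rw [h, h1m] at h0m; linarith
  have hI : ∀ t, t₀ < t → t < t₁ → m < K.H i f t ∧ K.H i f t < m + 1 := by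
    intro t h1 h2
    rw [← hmm]
    have ht01 : t ∈ Set.Icc (0 : ℝ) 1 := ⟨by linarith, by linarith⟩
    refine ⟨lt_of_le_of_ne (hmin t ht01) fun h => ?_, ?_⟩
    · exact absurd (hleast ⟨ht01, h.symm⟩) (not_le.mpr h2)
    · by_contra! h
      obtain ⟨t', ht', htm⟩ := intermediate_value_Icc' h2.le hcont.continuousOn
        (show K.mval i f + 1 ∈ Set.Icc (K.H i f t₁) (K.H i f t) from ⟨by rw [h1m]; linarith, h⟩)
      have := hgreat ⟨⟨by linarith [ht'.1], ht'.2⟩, htm⟩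
      linarith [ht'.1]
  have hr₁ : ∃ q : ℚ, (q : ℝ) = t₁ := by
    obtain ⟨k, hk, h1, h2⟩ := hf.exists_lt_le (h00.trans_lt hlt) h11
    refine hf.exists_rat hμ hk h1.le h2 (hf.slope_ne_zero hk le_rfl h1 h2 fun h => ?_)
      (h1m.trans hmm)
    have := hleast ⟨⟨hf.cast_nonneg hk.le, hf.cast_le_one hk.le⟩, h.trans h1m⟩
    linarith
  have hr₀ : ∃ q : ℚ, (q : ℝ) = t₀ := by
    obtain ⟨k, hk, h1, h2⟩ := hf.exists_le_lt h00 (hlt.trans_le h11)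
    refine hf.exists_rat hμ hk h1 h2.le (hf.slope_ne_zero hk h1 (lt_min h2 hlt)
      (min_le_left _ _) fun h => ?_) (n := m + 1) (by rw [h0m, hmm]; push_cast; ring)
    have h3 := lt_min h2 hlt
    have := hgreat ⟨⟨h00.trans h3.le, min_le_right _ _⟩, h.symm.trans h0m⟩
    linarith
  obtain ⟨s, ν, τ, hf, a, ha, b, hb, hτa, hτb⟩ := hf.exists_insert_two
    ⟨h00, h01.trans h11⟩ ⟨h10, h11⟩ hr₀ hr₁
  have hab : a < b := hf.lt_of_cast_lt ha (by rwa [hτa, hτb])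
  have hneg := hf.slope_neg_of_Ioo (i := i) hb (a := a) (m := m) (by rw [hτa, h0m, hmm])
    (by rwa [hτa, hτb])
  have hδ : K.refl i (f t₁ - f t₀) + f t₀ = f t₁ + K.α i := by
    have : K.coroot i (f t₁ - f t₀) = -1 := by
      rw [map_sub]
      change K.H i f t₁ - K.H i f t₀ = -1
      rw [h1m, h0m]; ring
    rw [refl_apply, this]; module
  refine (hf.reflect (i := i) hab hb (Or.inl hneg) (fun k h1 h2 n => ?_) ⟨m + 1, ?_⟩ ⟨m, ?_⟩
    (Or.inl (hneg a le_rfl hab)) (Or.inr fun hbs => ?_) (fun t ht => ?_) (fun t h1 h2 => ?_)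
    (δ := K.α i) (fun t ht => ?_)).mem_B
  · obtain ⟨h3, h4⟩ := hI (τ k) (hτa ▸ hf.cast_strictMono h1 (by omega))
      (hτb ▸ hf.cast_strictMono h2 hb)
    exact not_int_of_mem_Ioo h3 h4 n
  · rw [hτa, h0m, hmm]; push_cast; ring
  · rw [hτb, h1m, hmm]
  · refine hf.slope_nonneg hbs le_rfl (hf.cast_lt hbs) le_rfl ?_
    rw [hτb, h1m]
    exact hmin _ ⟨hf.cast_nonneg hbs, hf.cast_le_one hbs⟩
  · rw [hτa] at ht
    exact if_pos ht
  · rw [hτa] at h1 ⊢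
    rw [hτb] at h2
    rcases h1.eq_or_lt with rfl | h1
    · rw [show K.eraw i f t₀ = f t₀ from if_pos le_rfl]
      simp
    · exact (if_neg (not_le.mpr h1)).trans (if_pos h2)
  · rw [hτb] at ht
    refine (if_neg (not_le.mpr (hlt.trans_le ht))).trans ?_
    rcases ht.eq_or_lt with rfl | ht
    · exact (if_pos le_rfl).trans hδ
    · exact if_neg (not_le.mpr ht)

theorem fraw_mem_B (hμ : μ ∈ K.P) (hf : K.WeakLS μ f s ν τ)
    (hm : 1 ≤ K.H i f 1 - K.mval i f) : K.fraw i f ∈ K.B μ := by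
  obtain ⟨hex, hmin⟩ := hf.exists_isLeast_mval i
  have hcont := hf.continuous_H i
  obtain ⟨m, hmm⟩ : ∃ m : ℤ, K.mval i f = m := by
    obtain ⟨t, ht, htm⟩ := hex
    rw [← htm]
    exact hf.H_int_of_min hμ ht fun t' ht' => htm ▸ hmin t' ht'
  set S₀ := {t | t ∈ Set.Icc (0 : ℝ) 1 ∧ K.H i f t = K.mval i f}
  set t₀ := sSup S₀
  have hg : IsGreatest S₀ t₀ := by
    have hcl : IsClosed S₀ := isClosed_Icc.inter (isClosed_eq hcont continuous_const)
    have hbdd : BddAbove S₀ := ⟨1, fun t ht => ht.1.2⟩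
    exact ⟨hcl.csSup_mem hex hbdd, fun t ht => le_csSup hbdd ht⟩
  set S₁ := {t | t ∈ Set.Icc t₀ 1 ∧ K.H i f t = K.mval i f + 1}
  set t₁ := sInf S₁
  obtain ⟨⟨⟨h00, h01⟩, h0m⟩, hgreat⟩ := hg
  have hl : IsLeast S₁ t₁ := by
    have hcl : IsClosed S₁ := isClosed_Icc.inter (isClosed_eq hcont continuous_const)
    have hbdd : BddBelow S₁ := ⟨t₀, fun t ht => ht.1.1⟩
    have hne : S₁.Nonempty := by
      obtain ⟨t, ht, htm⟩ := intermediate_value_Icc h01 hcont.continuousOn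
        (show K.mval i f + 1 ∈ Set.Icc (K.H i f t₀) (K.H i f 1) by
          rw [h0m]; constructor <;> linarith)
      exact ⟨t, ht, htm⟩
    exact ⟨hcl.csInf_mem hne hbdd, fun t ht => csInf_le hbdd ht⟩
  obtain ⟨⟨⟨h10, h11⟩, h1m⟩, hleast⟩ := hl
  have hlt : t₀ < t₁ := lt_of_le_of_ne h10 fun h => by rw [← h, h0m] at h1m; linarith
  have hI : ∀ t, t₀ < t → t < t₁ → m < K.H i f t ∧ K.H i f t < m + 1 := by
    intro t h1 h2
    rw [← hmm]
    have ht01 : t ∈ Set.Icc (0 : ℝ) 1 := ⟨by linarith, by linarith⟩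
    refine ⟨lt_of_le_of_ne (hmin t ht01) fun h => ?_, ?_⟩
    · exact absurd (hgreat ⟨ht01, h.symm⟩) (not_le.mpr h1)
    · by_contra! h
      obtain ⟨t', ht', htm⟩ := intermediate_value_Icc h1.le hcont.continuousOn
        (show K.mval i f + 1 ∈ Set.Icc (K.H i f t₀) (K.H i f t) from ⟨by rw [h0m]; linarith, h⟩)
      have := hleast ⟨⟨ht'.1, by linarith [ht'.2]⟩, htm⟩
      linarith [ht'.2]
  have hr₀ : ∃ q : ℚ, (q : ℝ) = t₀ := by
    obtain ⟨k, hk, h1, h2⟩ := hf.exists_le_lt h00 (hlt.trans_le h11)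
    refine hf.exists_rat hμ hk h1 h2.le (hf.slope_ne_zero hk h1 h2 le_rfl fun h => ?_)
      (h0m.trans hmm)
    have := hgreat ⟨⟨hf.cast_nonneg hk, hf.cast_le_one hk⟩, h.symm.trans h0m⟩
    linarith
  have hr₁ : ∃ q : ℚ, (q : ℝ) = t₁ := by
    obtain ⟨k, hk, h1, h2⟩ := hf.exists_lt_le (h00.trans_lt hlt) h11
    have h3 := max_lt h1 hlt
    refine hf.exists_rat hμ hk h1.le h2 (hf.slope_ne_zero hk (le_max_left _ t₀) h3 h2
      fun h => ?_) (n := m + 1) (by rw [h1m, hmm]; push_cast; ring)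
    have := hleast ⟨⟨le_max_right _ _, h3.le.trans h11⟩, h.trans h1m⟩
    linarith
  obtain ⟨s, ν, τ, hf, a, ha, b, hb, hτa, hτb⟩ := hf.exists_insert_two
    ⟨h00, h01⟩ ⟨h00.trans h10, h11⟩ hr₀ hr₁
  have hab : a < b := hf.lt_of_cast_lt ha (by rwa [hτa, hτb])
  have hpos := hf.slope_pos_of_Ioo (i := i) hb (a := a) (m := m) (by rw [hτb, h1m, hmm])
    (by rwa [hτa, hτb])
  have hδ : K.refl i (f t₁ - f t₀) + f t₀ = f t₁ - K.α i := by
    have : K.coroot i (f t₁ - f t₀) = 1 := by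
      rw [map_sub]
      change K.H i f t₁ - K.H i f t₀ = 1
      rw [h1m, h0m]; ring
    rw [refl_apply, this]; module
  refine (hf.reflect (i := i) hab hb (Or.inr hpos) (fun k h1 h2 n => ?_) ⟨m, ?_⟩ ⟨m + 1, ?_⟩
    (Or.inr fun k hk => ?_) (Or.inl fun k hk => hpos k (by omega) (by omega))
    (fun t ht => ?_) (fun t h1 h2 => ?_) (δ := -K.α i) (fun t ht => ?_)).mem_B
  · obtain ⟨h3, h4⟩ := hI (τ k) (hτa ▸ hf.cast_strictMono h1 (by omega))
      (hτb ▸ hf.cast_strictMono h2 hb)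
    exact not_int_of_mem_Ioo h3 h4 n
  · rw [hτa, h0m, hmm]
  · rw [hτb, h1m, hmm]; push_cast; ring
  · subst hk
    refine hf.slope_nonpos ha le_rfl (hf.cast_lt ha) le_rfl ?_
    rw [hτa, h0m]
    exact hmin _ ⟨hf.cast_nonneg (by omega), hf.cast_le_one (by omega)⟩
  · rw [hτa] at ht
    exact if_pos ht
  · rw [hτa] at h1 ⊢
    rw [hτb] at h2
    rcases h1.eq_or_lt with rfl | h1
    · rw [show K.fraw i f t₀ = f t₀ from if_pos le_rfl]
      simp
    · exact (if_neg (not_le.mpr h1)).trans (if_pos h2)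
  · rw [hτb] at ht
    rw [← sub_eq_add_neg]
    refine (if_neg (not_le.mpr (hlt.trans_le ht))).trans ?_
    rcases ht.eq_or_lt with rfl | ht
    · exact (if_pos le_rfl).trans hδ
    · exact if_neg (not_le.mpr ht)

end WeakLS

end WeakLS

end KacMoodyData

end LSPaper

open LSPaper in
theorem statement0 {I V : Type*} [Fintype I] [DecidableEq I] [AddCommGroup V] [Module ℝ V]
    (K : KacMoodyData I V) (μ : V) (hμ : μ ∈ K.P)
    (f : ℝ → V) (hf : f ∈ K.B μ) (i : I) :
    (K.mval i f ≤ -1 → K.eraw i f ∈ K.B μ) ∧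
    (1 ≤ K.H i f 1 - K.mval i f → K.fraw i f ∈ K.B μ) := by
  obtain ⟨s, ν, τ, h⟩ := KacMoodyData.exists_weakLS hf
  exact ⟨h.eraw_mem_B hμ, h.fraw_mem_B hμ⟩
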